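/- If G is a minimal counterexample, then G has at most one vertex of degree 2. -/

import Mathlib

open SimpleGraph

/-- A `(1,2^k)`-packing edge-coloring encoded as a function assigning a color in
`Fin (k+1)` to each unordered pair. Color `0` is the 1-color (its class must be a
matching) and each color `i ≠ 0` is a 2-color (its class must be an induced matching). -/
def IsPackingEC {V : Type} (G : SimpleGraph V) (k : ℕ)
    (c : Sym2 V → Fin (k + 1)) : Prop :=
  (∀ a b x y : V, G.Adj a b → G.Adj x y → s(a, b) ≠ s(x, y) →
      c s(a, b) = 0 → c s(x, y) = 0 →
      a ≠ x ∧ a ≠ y ∧ b ≠ x ∧ b ≠ y) ∧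
  ∀ a b x y : V, G.Adj a b → G.Adj x y → s(a, b) ≠ s(x, y) →
      c s(a, b) = c s(x, y) → c s(a, b) ≠ 0 →
      (a ≠ x ∧ a ≠ y ∧ b ≠ x ∧ b ≠ y) ∧
      ¬G.Adj a x ∧ ¬G.Adj a y ∧ ¬G.Adj b x ∧ ¬G.Adj b y

/-- A good coloring: a `(1,2^7)`-packing edge-coloring in which every edge of the
1-color class (color `0`) has both endpoints of degree 3. -/
def GoodColoring {V : Type} (G : SimpleGraph V) (c : Sym2 V → Fin 8) : Prop :=
  IsPackingEC G 7 c ∧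
  ∀ a b : V, G.Adj a b → c s(a, b) = 0 →
    (G.neighborSet a).ncard = 3 ∧ (G.neighborSet b).ncard = 3

/-- A graph is subcubic if every vertex has degree at most 3. -/
def Subcubic {V : Type} (G : SimpleGraph V) : Prop :=
  ∀ v : V, (G.neighborSet v).ncard ≤ 3

/-- A minimal counterexample: a finite subcubic simple graph with no good coloring such
that every finite subcubic simple graph with smaller `|V| + |E|` has a good coloring. -/
def MinCounter (V : Type) [Finite V] (G : SimpleGraph V) : Prop :=
  Subcubic G ∧
  (¬∃ c : Sym2 V → Fin 8, GoodColoring G c) ∧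
  ∀ (W : Type) [Finite W] (H : SimpleGraph W), Subcubic H →
    Nat.card W + H.edgeSet.ncard < Nat.card V + G.edgeSet.ncard →
    ∃ c : Sym2 W → Fin 8, GoodColoring H c

namespace PackingColoring

variable {V : Type} {G : SimpleGraph V} {d : Sym2 V → Fin 8} {M : Set (Sym2 V)}

/-- The nonzero colors of `d` form induced matchings of `G`; color `0` is unconstrained. -/
def Valid (G : SimpleGraph V) (d : Sym2 V → Fin 8) : Prop :=
  ∀ a b x y : V, G.Adj a b → G.Adj x y → s(a, b) ≠ s(x, y) →
    d s(a, b) = d s(x, y) → d s(a, b) ≠ 0 →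
    (a ≠ x ∧ a ≠ y ∧ b ≠ x ∧ b ≠ y) ∧
    ¬G.Adj a x ∧ ¬G.Adj a y ∧ ¬G.Adj b x ∧ ¬G.Adj b y

/-- `M` is a matching all of whose edges join vertices of degree 3. -/
structure ZeroClass (G : SimpleGraph V) (M : Set (Sym2 V)) : Prop where
  adj : ∀ a b, s(a, b) ∈ M → G.Adj a b
  deg : ∀ a b, s(a, b) ∈ M → (G.neighborSet a).ncard = 3
  unique : ∀ a b c, s(a, b) ∈ M → s(a, c) ∈ M → b = c

open scoped Classical in
/-- The nonzero colors that `d` puts on the edges at `v`. -/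
noncomputable def nz (G : SimpleGraph V) (d : Sym2 V → Fin 8) (v : V) : Finset (Fin 8) :=
  Finset.univ.filter fun α => α ≠ 0 ∧ ∃ w, G.Adj v w ∧ d s(v, w) = α

theorem mem_nz {v : V} {α : Fin 8} :
    α ∈ nz G d v ↔ α ≠ 0 ∧ ∃ w, G.Adj v w ∧ d s(v, w) = α := by
  simp [nz]

theorem good_of_valid (hM : ZeroClass G M) (hd : Valid G d)
    (h : ∀ a b, G.Adj a b → d s(a, b) = 0 → s(a, b) ∈ M) : GoodColoring G d := by
  refine ⟨⟨fun a b x y hab hxy hne h0 h1 => ?_, hd⟩, fun a b hab h0 => ?_⟩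
  · have h2 := h a b hab h0
    have h3 := h x y hxy h1
    have h2' := Sym2.eq_swap ▸ h2
    have h3' := Sym2.eq_swap ▸ h3
    refine ⟨?_, ?_, ?_, ?_⟩ <;> rintro rfl <;> apply hne
    · rw [hM.unique _ _ _ h2 h3]
    · rw [hM.unique _ _ _ h2 h3', Sym2.eq_swap]
    · rw [Sym2.eq_swap, hM.unique _ _ _ h2' h3]
    · rw [Sym2.eq_swap, hM.unique _ _ _ h2' h3', Sym2.eq_swap]
  · have h2 := h a b hab h0
    exact ⟨hM.deg _ _ h2, hM.deg _ _ (Sym2.eq_swap ▸ h2)⟩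

theorem ZeroClass.insert (hM : ZeroClass G M) {a b : V} (hab : G.Adj a b)
    (ha : (G.neighborSet a).ncard = 3) (hb : (G.neighborSet b).ncard = 3)
    (ha' : ∀ x, s(a, x) ∉ M) (hb' : ∀ x, s(b, x) ∉ M) :
    ZeroClass G (insert s(a, b) M) := by
  constructor
  · intro x y h
    rcases h with h | h
    · rcases Sym2.eq_iff.1 h with ⟨rfl, rfl⟩ | ⟨rfl, rfl⟩
      exacts [hab, hab.symm]
    · exact hM.adj _ _ h
  · intro x y h
    rcases h with h | h
    · rcases Sym2.eq_iff.1 h with ⟨rfl, rfl⟩ | ⟨rfl, rfl⟩ <;> assumption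
    · exact hM.deg _ _ h
  · intro x y z h h'
    rcases h with h | h <;> rcases h' with h' | h'
    · rcases Sym2.eq_iff.1 h with ⟨rfl, rfl⟩ | ⟨rfl, rfl⟩ <;>
      rcases Sym2.eq_iff.1 h' with ⟨h1, rfl⟩ | ⟨h1, rfl⟩ <;> simp_all
    · rcases Sym2.eq_iff.1 h with ⟨rfl, rfl⟩ | ⟨rfl, rfl⟩
      · exact absurd h' (ha' _)
      · exact absurd h' (hb' _)
    · rcases Sym2.eq_iff.1 h' with ⟨rfl, rfl⟩ | ⟨rfl, rfl⟩
      · exact absurd h (ha' _)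
      · exact absurd h (hb' _)
    · exact hM.unique _ _ _ h h'

section Extension

variable [DecidableEq V]

/-- Recoloring one edge with a color missing around it. -/
theorem Valid.update (hd : Valid G d) {x y : V} (hxy : G.Adj x y) {α : Fin 8}
    (h : α ≠ 0 → ∀ z w, (G.Adj x z ∨ G.Adj y z) → G.Adj z w → s(z, w) ≠ s(x, y) →
      d s(z, w) ≠ α) :
    Valid G (Function.update d s(x, y) α) := by
  have key : α ≠ 0 → ∀ a b, G.Adj a b → s(a, b) ≠ s(x, y) → d s(a, b) = α →
      (x ≠ a ∧ x ≠ b ∧ y ≠ a ∧ y ≠ b) ∧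
      ¬G.Adj x a ∧ ¬G.Adj x b ∧ ¬G.Adj y a ∧ ¬G.Adj y b := by
    intro hα a b hab hne hc
    have h1 : ∀ z w, s(z, w) = s(a, b) → ¬ (G.Adj x z ∨ G.Adj y z) := by
      intro z w hzw hz
      refine h hα z w hz ?_ (hzw ▸ hne) (hzw ▸ hc)
      rw [← SimpleGraph.mem_edgeSet, hzw]; exact hab
    have ha := h1 a b rfl
    have hb := h1 b a Sym2.eq_swap
    push Not at ha hb
    refine ⟨⟨?_, ?_, ?_, ?_⟩, ha.1, hb.1, ha.2, hb.2⟩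
    · rintro rfl; exact hb.1 hab
    · rintro rfl; exact ha.1 hab.symm
    · rintro rfl; exact hb.2 hab
    · rintro rfl; exact ha.2 hab.symm
  intro a b u v hab huv hne he h0
  by_cases h1 : s(a, b) = s(x, y)
  · have h2 : s(u, v) ≠ s(x, y) := fun h2 => hne (h1.trans h2.symm)
    rw [h1, Function.update_self, Function.update_of_ne h2] at he
    rw [h1, Function.update_self] at h0
    have := key h0 u v huv h2 he.symm
    rcases Sym2.eq_iff.1 h1 with ⟨rfl, rfl⟩ | ⟨rfl, rfl⟩ <;> tauto
  · rw [Function.update_of_ne h1] at he h0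
    by_cases h2 : s(u, v) = s(x, y)
    · rw [h2, Function.update_self] at he
      have := key (he ▸ h0) a b hab h1 he
      simp only [G.adj_comm x, G.adj_comm y, ne_comm (a := x), ne_comm (a := y)] at this
      rcases Sym2.eq_iff.1 h2 with ⟨rfl, rfl⟩ | ⟨rfl, rfl⟩ <;> tauto
    · rw [Function.update_of_ne h2] at he
      exact hd a b u v hab huv hne he h0

theorem Valid.update_zero (hd : Valid G d) {x y : V} (hxy : G.Adj x y) :
    Valid G (Function.update d s(x, y) 0) :=
  hd.update hxy fun h => absurd rfl h

/-- An uncolored edge can be colored when at most six colors appear around it. -/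
theorem Valid.extend (hd : Valid G d) {x y : V} (hxy : G.Adj x y) (T : Finset (Fin 8))
    (hT : T.card ≤ 6) (hx : ∀ z, G.Adj x z → nz G d z ⊆ T) (hy : ∀ z, G.Adj y z → nz G d z ⊆ T) :
    ∃ α, α ≠ 0 ∧ Valid G (Function.update d s(x, y) α) := by
  obtain ⟨α, hα⟩ : ∃ α, α ∉ insert 0 T := by
    by_contra! hall
    have h1 : (Finset.univ : Finset (Fin 8)) ⊆ insert 0 T := fun a _ => hall a
    have h2 := Finset.card_le_card h1
    have h3 := Finset.card_insert_le 0 T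
    simp at h2
    omega
  rw [Finset.mem_insert, not_or] at hα
  refine ⟨α, hα.1, hd.update hxy fun _ z w hz hzw _ he => hα.2 ?_⟩
  have : α ∈ nz G d z := mem_nz.2 ⟨hα.1, w, hzw, he⟩
  exact hz.elim (fun h => hx z h this) (fun h => hy z h this)

end Extension

theorem nz_subset {T : Finset (Fin 8)} {v : V}
    (h : ∀ w, G.Adj v w → d s(v, w) ≠ 0 → d s(v, w) ∈ T) : nz G d v ⊆ T := by
  intro α hα
  obtain ⟨h0, w, hw, rfl⟩ := mem_nz.1 hα
  exact h w hw h0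

theorem color_mem_nz_left {v w : V} (h : G.Adj v w) (h0 : d s(v, w) ≠ 0) :
    d s(v, w) ∈ nz G d v :=
  mem_nz.2 ⟨h0, w, h, rfl⟩

theorem color_mem_nz_right {v w : V} (h : G.Adj v w) (h0 : d s(v, w) ≠ 0) :
    d s(v, w) ∈ nz G d w :=
  mem_nz.2 ⟨h0, v, h.symm, by rw [Sym2.eq_swap]⟩

section Counting

variable [Finite V]

theorem card_nz_le_ncard (S : Set V) (v : V)
    (h : ∀ w, G.Adj v w → d s(v, w) ≠ 0 → w ∈ S) : (nz G d v).card ≤ S.ncard := by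
  have : (nz G d v : Set (Fin 8)) ⊆ (fun w => d s(v, w)) '' S := by
    intro α hα
    obtain ⟨h0, w, hw, rfl⟩ := mem_nz.1 hα
    exact ⟨w, h w hw h0, rfl⟩
  rw [← Set.ncard_coe_finset]
  exact (Set.ncard_le_ncard this (Set.toFinite _)).trans (Set.ncard_image_le (Set.toFinite _))

theorem card_nz_le (v : V) : (nz G d v).card ≤ (G.neighborSet v).ncard :=
  card_nz_le_ncard _ v fun _ h _ => h

theorem card_nz_le_three (hG : Subcubic G) (v : V) : (nz G d v).card ≤ 3 :=
  (card_nz_le v).trans (hG v)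

theorem card_nz_le_two (hG : Subcubic G) {v w : V} (hvw : G.Adj v w) (h : d s(v, w) = 0) :
    (nz G d v).card ≤ 2 := by
  have h1 := card_nz_le_ncard (G := G) (d := d) (G.neighborSet v \ {w}) v
    (fun z hz hz0 => ⟨hz, by rintro rfl; exact hz0 h⟩)
  have h2 := Set.ncard_sdiff_singleton_lt_of_mem (s := G.neighborSet v) (a := w) hvw
  have := hG v
  omega

/-- The at most one neighbor besides two given ones. -/
theorem exists_third_neighbor (hG : Subcubic G) {v x y : V} (hx : G.Adj v x) (hy : G.Adj v y)
    (hxy : x ≠ y) : ∃ w, ∀ z, G.Adj v z → z = x ∨ z = y ∨ z = w := by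
  by_contra! h
  obtain ⟨w, hw, hwx, hwy, -⟩ := h x
  obtain ⟨z, hz, hzx, hzy, hzw⟩ := h w
  have h1 : ({x, y, w, z} : Set V) ⊆ G.neighborSet v := by
    rintro a (rfl | rfl | rfl | rfl) <;> assumption
  have h2 := Set.ncard_le_ncard h1 (Set.toFinite _)
  rw [Set.ncard_insert_of_notMem (by simp [hxy, hwx.symm, hzx.symm]),
    Set.ncard_insert_of_notMem (by simp [hwy.symm, hzy.symm]),
    Set.ncard_pair hzw.symm] at h2
  have := hG v
  omega

/-- The at most two neighbors besides a given one. -/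
theorem exists_two_neighbors (hG : Subcubic G) {v x : V} (hx : G.Adj v x) :
    ∃ y z, G.Adj v y ∧ G.Adj v z ∧ ∀ w, G.Adj v w → w = x ∨ w = y ∨ w = z := by
  by_cases h : ∃ y, G.Adj v y ∧ y ≠ x
  · obtain ⟨y, hy, hyx⟩ := h
    by_cases h' : ∃ z, G.Adj v z ∧ z ≠ x ∧ z ≠ y
    · obtain ⟨z, hz, hzx, hzy⟩ := h'
      obtain ⟨t, ht⟩ := exists_third_neighbor hG hx hy hyx.symm
      refine ⟨y, z, hy, hz, fun w hw => ?_⟩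
      have := ht z hz
      have := ht w hw
      grind
    · push Not at h'
      exact ⟨y, y, hy, hy, fun w hw => by have := h' w hw; tauto⟩
  · push Not at h
    exact ⟨x, x, hx, hx, fun w hw => Or.inl (h w hw)⟩

/-- The other neighbor of a vertex of degree at most 2. -/
theorem exists_other_neighbor {v x : V} (h2 : (G.neighborSet v).ncard ≤ 2) (hx : G.Adj v x) :
    ∃ y, ∀ w, G.Adj v w → w = x ∨ w = y := by
  by_contra! h
  obtain ⟨y, hy, hyx, -⟩ := h x
  obtain ⟨z, hz, hzx, hzy⟩ := h y
  have h1 : ({x, y, z} : Set V) ⊆ G.neighborSet v := by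
    rintro a (rfl | rfl | rfl) <;> assumption
  have h3 := Set.ncard_le_ncard h1 (Set.toFinite _)
  rw [Set.ncard_insert_of_notMem (by simp [hyx.symm, hzx.symm]), Set.ncard_pair hzy.symm] at h3
  omega

end Counting

section Minimality

variable [Finite V]

theorem ncard_neighborSet_eq_three (hG : Subcubic G) {H : SimpleGraph V} (hle : H ≤ G) {a : V}
    (h : (H.neighborSet a).ncard = 3) : (G.neighborSet a).ncard = 3 := by
  have : H.neighborSet a ⊆ G.neighborSet a := fun _ hw => hle hw
  have := Set.ncard_le_ncard this (Set.toFinite _)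
  have := hG a
  omega

theorem exists_good_of_lt (hG : MinCounter V G) {H : SimpleGraph V} (hlt : H < G) :
    ∃ c, GoodColoring H c := by
  refine hG.2.2 V H (fun v => ?_) ?_
  · have : H.neighborSet v ⊆ G.neighborSet v := fun _ hw => hlt.le hw
    exact (Set.ncard_le_ncard this (Set.toFinite _)).trans (hG.1 v)
  · have : H.edgeSet ⊂ G.edgeSet := SimpleGraph.edgeSet_ssubset_edgeSet.2 hlt
    have := Set.ncard_lt_ncard this (Set.toFinite _)
    omega

/-- A partial coloring of `G` with `0`-class `M` in which exactly the edges meeting `X` are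
uncolored. -/
structure Avoids (G : SimpleGraph V) (X : Set V) (M : Set (Sym2 V)) (d : Sym2 V → Fin 8) :
    Prop where
  zeroClass : ZeroClass G M
  valid : Valid G d
  zero : ∀ e ∈ M, d e = 0
  inside : ∀ a b, G.Adj a b → a ∈ X → d s(a, b) = 0
  outside : ∀ a b, G.Adj a b → a ∉ X → b ∉ X → d s(a, b) = 0 → s(a, b) ∈ M
  notMem : ∀ x ∈ X, ∀ b, s(x, b) ∉ M
  notMem_of_adj : ∀ x ∈ X, ∀ a, G.Adj x a → ∀ b, s(a, b) ∉ M

theorem exists_avoids (hG : MinCounter V G) {X : Set V} {x y : V} (hx : x ∈ X)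
    (hxy : G.Adj x y) : ∃ M d, Avoids G X M d := by
  classical
  let H : SimpleGraph V :=
    { Adj := fun a b => G.Adj a b ∧ a ∉ X ∧ b ∉ X
      symm := ⟨fun a b h => ⟨h.1.symm, h.2.2, h.2.1⟩⟩
      loopless := ⟨fun a h => G.irrefl h.1⟩ }
  have hle : H ≤ G := fun a b h => h.1
  have hlt : H < G := lt_of_le_of_ne hle fun h => by
    have : H.Adj x y := h ▸ hxy
    exact this.2.1 hx
  obtain ⟨c, hc⟩ := exists_good_of_lt hG hlt
  refine ⟨{e | e ∈ H.edgeSet ∧ c e = 0}, fun e => if e ∈ H.edgeSet then c e else 0,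
    ⟨fun a b h => hle h.1, fun a b h => ncard_neighborSet_eq_three hG.1 hle (hc.2 a b h.1 h.2).1, ?_⟩,
    ?_, fun e he => by simp [he.1, he.2], ?_, ?_, ?_, ?_⟩
  · intro a b b' h h'
    by_contra hne
    exact (hc.1.1 a b a b' h.1 h'.1 (fun h => hne (Sym2.congr_right.1 h)) h.2 h'.2).1 rfl
  · intro a b u v hab huv hne he h0
    have h1 : H.Adj a b := by by_contra h1; simp [h1] at h0
    have h2 : H.Adj u v := by by_contra h2; rw [he] at h0; simp [h2] at h0
    simp only [SimpleGraph.mem_edgeSet, h1, h2, if_true] at he h0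
    have := hc.1.2 a b u v h1 h2 hne he h0
    refine ⟨this.1, ?_, ?_, ?_, ?_⟩ <;> intro h
    · exact this.2.1 ⟨h, h1.2.1, h2.2.1⟩
    · exact this.2.2.1 ⟨h, h1.2.1, h2.2.2⟩
    · exact this.2.2.2.1 ⟨h, h1.2.2, h2.2.1⟩
    · exact this.2.2.2.2 ⟨h, h1.2.2, h2.2.2⟩
  · intro a b _ ha
    have : ¬ H.Adj a b := fun h => h.2.1 ha
    simp [this]
  · intro a b hab ha hb h0
    have h1 : H.Adj a b := ⟨hab, ha, hb⟩
    simp only [SimpleGraph.mem_edgeSet, h1, if_true] at h0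
    exact ⟨h1, h0⟩
  · intro z hz b h
    exact h.1.2.1 hz
  · intro z hz a hza b h
    have h3 := (hc.2 a b h.1 h.2).1
    have h4 : H.neighborSet a ⊂ G.neighborSet a :=
      ⟨fun _ hw => hle hw, fun h => (h hza.symm : H.Adj a z).2.2 hz⟩
    have := Set.ncard_lt_ncard h4 (Set.toFinite _)
    have := hG.1 a
    omega

theorem false_of_valid (hG : MinCounter V G) (hM : ZeroClass G M) (hd : Valid G d)
    (h : ∀ a b, G.Adj a b → d s(a, b) = 0 → s(a, b) ∈ M) : False :=
  hG.2.1 ⟨d, good_of_valid hM hd h⟩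

theorem ncard_neighborSet_ne_one (hG : MinCounter V G) (x : V) :
    (G.neighborSet x).ncard ≠ 1 := by
  classical
  intro hx
  obtain ⟨y, hy⟩ := Set.ncard_eq_one.1 hx
  have hN : ∀ z, G.Adj x z ↔ z = y := fun z => by
    rw [← SimpleGraph.mem_neighborSet, hy, Set.mem_singleton_iff]
  have hxy : G.Adj x y := (hN y).2 rfl
  obtain ⟨M, d, hd⟩ := exists_avoids hG (Set.mem_singleton x) hxy
  obtain ⟨y₁, y₂, -, -, hy₁₂⟩ := exists_two_neighbors hG.1 hxy.symm
  have hnx : nz G d x = ∅ := by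
    ext α
    simp only [mem_nz, Finset.notMem_empty, iff_false]
    rintro ⟨h0, w, hw, rfl⟩
    exact h0 (hd.inside x w hw rfl)
  have h1 := card_nz_le_three (d := d) hG.1 y₁
  have h2 := card_nz_le_three (d := d) hG.1 y₂
  have h3 := Finset.card_union_le (nz G d y₁) (nz G d y₂)
  have hyz : ∀ z, G.Adj y z → nz G d z ⊆ nz G d y₁ ∪ nz G d y₂ := by
    intro z hz
    rcases hy₁₂ z hz with rfl | rfl | rfl
    · simp [hnx]
    · exact Finset.subset_union_left
    · exact Finset.subset_union_right
  obtain ⟨α, hα, hv⟩ := hd.valid.extend hxy (nz G d y₁ ∪ nz G d y₂) (by omega)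
    (by
      intro z hz β hβ
      obtain rfl := (hN z).1 hz
      obtain ⟨h0, w, hw, rfl⟩ := mem_nz.1 hβ
      refine hyz w hw (mem_nz.2 ⟨h0, z, hw.symm, ?_⟩)
      rw [Sym2.eq_swap])
    hyz
  refine false_of_valid hG hd.zeroClass hv fun a b hab h0 => ?_
  have hne : s(a, b) ≠ s(x, y) := by
    intro h
    rw [h, Function.update_self] at h0
    exact hα h0
  rw [Function.update_of_ne hne] at h0
  refine hd.outside a b hab ?_ ?_ h0
  · rintro rfl
    exact hne (by rw [(hN b).1 hab])
  · rintro rfl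
    exact hne (by rw [(hN a).1 hab.symm, Sym2.eq_swap])

theorem reachable_of_minCounter (hG : MinCounter V G) {x x' y y' : V} (hx : G.Adj x x')
    (hy : G.Adj y y') : G.Reachable x y := by
  classical
  by_contra hxy
  have hr : ∀ a b, G.Adj a b → (G.Reachable x a ↔ G.Reachable x b) := fun a b hab =>
    ⟨fun h => h.trans hab.reachable, fun h => h.trans hab.symm.reachable⟩
  let H₁ : SimpleGraph V :=
    { Adj := fun a b => G.Adj a b ∧ G.Reachable x a
      symm := ⟨fun a b h => ⟨h.1.symm, (hr a b h.1).1 h.2⟩⟩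
      loopless := ⟨fun a h => G.irrefl h.1⟩ }
  let H₂ : SimpleGraph V :=
    { Adj := fun a b => G.Adj a b ∧ ¬ G.Reachable x a
      symm := ⟨fun a b h => ⟨h.1.symm, fun h' => h.2 ((hr a b h.1).2 h')⟩⟩
      loopless := ⟨fun a h => G.irrefl h.1⟩ }
  have hle₁ : H₁ ≤ G := fun a b h => h.1
  have hle₂ : H₂ ≤ G := fun a b h => h.1
  obtain ⟨c₁, h₁⟩ := exists_good_of_lt hG
    (lt_of_le_of_ne hle₁ fun h => hxy (h ▸ hy : H₁.Adj y y').2)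
  obtain ⟨c₂, h₂⟩ := exists_good_of_lt hG
    (lt_of_le_of_ne hle₂ fun h => (h ▸ hx : H₂.Adj x x').2 (SimpleGraph.Reachable.refl x))
  let c : Sym2 V → Fin 8 := fun e => if e ∈ H₁.edgeSet then c₁ e else c₂ e
  have hc₁ : ∀ a b, G.Adj a b → G.Reachable x a → H₁.Adj a b ∧ c s(a, b) = c₁ s(a, b) := by
    intro a b hab h
    have : H₁.Adj a b := ⟨hab, h⟩
    exact ⟨this, by simp [c, this]⟩
  have hc₂ : ∀ a b, G.Adj a b → ¬ G.Reachable x a → H₂.Adj a b ∧ c s(a, b) = c₂ s(a, b) := by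
    intro a b hab h
    have : ¬ H₁.Adj a b := fun h' => h h'.2
    exact ⟨⟨hab, h⟩, by simp [c, this]⟩
  have hsep : ∀ a u, ¬ (G.Reachable x a ↔ G.Reachable x u) → a ≠ u ∧ ¬ G.Adj a u :=
    fun a u h => ⟨by rintro rfl; exact h Iff.rfl, fun h' => h (hr a u h')⟩
  refine hG.2.1 ⟨c, ⟨⟨?_, ?_⟩, ?_⟩⟩
  · intro a b u v hab huv hne ha hu
    have hb := hr a b hab
    have hv := hr u v huv
    by_cases h : G.Reachable x a ↔ G.Reachable x u
    · by_cases h' : G.Reachable x a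
      · obtain ⟨e₁, e₂⟩ := hc₁ a b hab h'
        obtain ⟨e₃, e₄⟩ := hc₁ u v huv (h.1 h')
        exact h₁.1.1 a b u v e₁ e₃ hne (e₂ ▸ ha) (e₄ ▸ hu)
      · obtain ⟨e₁, e₂⟩ := hc₂ a b hab h'
        obtain ⟨e₃, e₄⟩ := hc₂ u v huv (fun h'' => h' (h.2 h''))
        exact h₂.1.1 a b u v e₁ e₃ hne (e₂ ▸ ha) (e₄ ▸ hu)
    · exact ⟨(hsep a u h).1, (hsep a v (by tauto)).1, (hsep b u (by tauto)).1,
        (hsep b v (by tauto)).1⟩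
  · intro a b u v hab huv hne he h0
    have hb := hr a b hab
    have hv := hr u v huv
    by_cases h : G.Reachable x a ↔ G.Reachable x u
    · by_cases h' : G.Reachable x a
      · obtain ⟨e₁, e₂⟩ := hc₁ a b hab h'
        obtain ⟨e₃, e₄⟩ := hc₁ u v huv (h.1 h')
        have := h₁.1.2 a b u v e₁ e₃ hne (by rw [← e₂, ← e₄, he]) (e₂ ▸ h0)
        refine ⟨this.1, fun k => this.2.1 ⟨k, h'⟩, fun k => this.2.2.1 ⟨k, h'⟩,
          fun k => this.2.2.2.1 ⟨k, hb.1 h'⟩, fun k => this.2.2.2.2 ⟨k, hb.1 h'⟩⟩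
      · obtain ⟨e₁, e₂⟩ := hc₂ a b hab h'
        obtain ⟨e₃, e₄⟩ := hc₂ u v huv (fun h'' => h' (h.2 h''))
        have := h₂.1.2 a b u v e₁ e₃ hne (by rw [← e₂, ← e₄, he]) (e₂ ▸ h0)
        have hb' : ¬ G.Reachable x b := fun k => h' (hb.2 k)
        exact ⟨this.1, fun k => this.2.1 ⟨k, h'⟩, fun k => this.2.2.1 ⟨k, h'⟩,
          fun k => this.2.2.2.1 ⟨k, hb'⟩, fun k => this.2.2.2.2 ⟨k, hb'⟩⟩
    · have k₁ := hsep a u h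
      have k₂ := hsep a v (by tauto)
      have k₃ := hsep b u (by tauto)
      have k₄ := hsep b v (by tauto)
      exact ⟨⟨k₁.1, k₂.1, k₃.1, k₄.1⟩, k₁.2, k₂.2, k₃.2, k₄.2⟩
  · intro a b hab h0
    by_cases h' : G.Reachable x a
    · obtain ⟨e₁, e₂⟩ := hc₁ a b hab h'
      have := h₁.2 a b e₁ (e₂ ▸ h0)
      exact ⟨ncard_neighborSet_eq_three hG.1 hle₁ this.1,
        ncard_neighborSet_eq_three hG.1 hle₁ this.2⟩
    · obtain ⟨e₁, e₂⟩ := hc₂ a b hab h'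
      have := h₂.2 a b e₁ (e₂ ▸ h0)
      exact ⟨ncard_neighborSet_eq_three hG.1 hle₂ this.1,
        ncard_neighborSet_eq_three hG.1 hle₂ this.2⟩

end Minimality

/-- An induced path `p 0, …, p (m + 1)` whose ends have degree 2 and whose inner vertices have
degree 3, together with the neighbors `t i` of `p i` off the path. -/
structure Ladder (G : SimpleGraph V) (m : ℕ) (p t : ℕ → V) : Prop where
  inj : ∀ i j, i ≤ m + 1 → j ≤ m + 1 → p i = p j → i = j
  off : ∀ i j, i ≤ m + 1 → j ≤ m + 1 → t i ≠ p j
  first : ∀ z, G.Adj (p 0) z ↔ z = p 1 ∨ z = t 0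
  mid : ∀ i, i < m → ∀ z, G.Adj (p (i + 1)) z ↔ z = p i ∨ z = p (i + 2) ∨ z = t (i + 1)
  last : ∀ z, G.Adj (p (m + 1)) z ↔ z = p m ∨ z = t (m + 1)
  near : ∀ i j, i < j → j ≤ m + 1 → t i = t j → j ≤ i + 2
  deg_t : ∀ i, i < m → (G.neighborSet (t (i + 1))).ncard = 3
  deg_p : ∀ i, i < m → (G.neighborSet (p (i + 1))).ncard = 3

namespace Ladder

variable {m : ℕ} {p t : ℕ → V} (L : Ladder G m p t)
include L

theorem adj_t {i : ℕ} (hi : i ≤ m + 1) : G.Adj (p i) (t i) := by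
  rcases i with _ | i
  · exact (L.first _).2 (Or.inr rfl)
  · by_cases h : i < m
    · exact (L.mid i h _).2 (Or.inr (Or.inr rfl))
    · obtain rfl : i = m := by omega
      exact (L.last _).2 (Or.inr rfl)

theorem adj_succ {i : ℕ} (hi : i ≤ m) : G.Adj (p i) (p (i + 1)) := by
  rcases i with _ | i
  · exact (L.first _).2 (Or.inl rfl)
  · exact (L.mid i (by omega) _).2 (Or.inr (Or.inl rfl))

theorem eq_of_adj {i : ℕ} (hi : i ≤ m + 1) {z : V} (h : G.Adj (p i) z) :
    z = t i ∨ ∃ j, j ≤ m + 1 ∧ (j = i + 1 ∨ j + 1 = i) ∧ z = p j := by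
  rcases i with _ | i
  · rcases (L.first _).1 h with rfl | rfl
    · exact Or.inr ⟨1, by omega, by omega, rfl⟩
    · exact Or.inl rfl
  · by_cases hm : i < m
    · rcases (L.mid i hm _).1 h with rfl | rfl | rfl
      · exact Or.inr ⟨i, by omega, by omega, rfl⟩
      · exact Or.inr ⟨i + 2, by omega, by omega, rfl⟩
      · exact Or.inl rfl
    · obtain rfl : i = m := by omega
      rcases (L.last _).1 h with rfl | rfl
      · exact Or.inr ⟨i, by omega, by omega, rfl⟩
      · exact Or.inl rfl

theorem eq_edge {i : ℕ} (hi : i ≤ m + 1) {z : V} (h : G.Adj (p i) z) :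
    s(p i, z) = s(p i, t i) ∨ ∃ j, j ≤ m ∧ (j = i ∨ j + 1 = i) ∧ s(p i, z) = s(p j, p (j + 1)) := by
  rcases L.eq_of_adj hi h with rfl | ⟨j, hj, rfl | rfl, rfl⟩
  · exact Or.inl rfl
  · exact Or.inr ⟨i, by omega, by omega, rfl⟩
  · exact Or.inr ⟨j, by omega, by omega, Sym2.eq_swap⟩

theorem nz_path_subset {i : ℕ} (hi : i ≤ m + 1) {T : Finset (Fin 8)}
    (ht : d s(p i, t i) ≠ 0 → d s(p i, t i) ∈ T)
    (he : ∀ j, j ≤ m → (j = i ∨ j + 1 = i) → d s(p j, p (j + 1)) ≠ 0 →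
      d s(p j, p (j + 1)) ∈ T) : nz G d (p i) ⊆ T := by
  refine nz_subset fun w hw h0 => ?_
  rcases L.eq_edge hi hw with h | ⟨j, hj, hji, h⟩
  · rw [h] at h0 ⊢; exact ht h0
  · rw [h] at h0 ⊢; exact he j hj hji h0

theorem t_ne_path {i j : ℕ} (hi : i ≤ m + 1) (hj : j ≤ m) :
    s(p i, t i) ≠ s(p j, p (j + 1)) := by
  intro h
  rcases Sym2.eq_iff.1 h with ⟨_, h⟩ | ⟨_, h⟩
  · exact L.off i (j + 1) hi (by omega) h
  · exact L.off i j hi (by omega) h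

theorem t_inj {i j : ℕ} (hi : i ≤ m + 1) (hj : j ≤ m + 1)
    (h : s(p i, t i) = s(p j, t j)) : i = j := by
  rcases Sym2.eq_iff.1 h with ⟨h, _⟩ | ⟨h, _⟩
  · exact L.inj i j hi hj h
  · exact absurd h.symm (L.off j i hj hi)

theorem path_inj {i j : ℕ} (hi : i ≤ m) (hj : j ≤ m)
    (h : s(p i, p (i + 1)) = s(p j, p (j + 1))) : i = j := by
  rcases Sym2.eq_iff.1 h with ⟨h, _⟩ | ⟨h, h'⟩
  · exact L.inj i j (by omega) (by omega) h
  · have := L.inj _ _ (by omega) (by omega) h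
    have := L.inj _ _ (by omega) (by omega) h'
    omega

theorem ncard_first [Finite V] : (G.neighborSet (p 0)).ncard ≤ 2 := by
  have : G.neighborSet (p 0) = {p 1, t 0} := by ext z; simp [L.first]
  rw [this]
  exact Set.ncard_insert_le _ _ |>.trans (by simp)

end Ladder

/-- `M` avoids the path and saturates all `t i` for inner `i`. -/
structure Saturates (m : ℕ) (p t : ℕ → V) (M : Set (Sym2 V)) : Prop where
  notMem : ∀ j, j ≤ m → s(p j, p (j + 1)) ∉ M
  last_notMem : s(p (m + 1), t (m + 1)) ∉ M
  exists_mem : ∀ i, i < m → ∃ j, i ≤ j ∧ j < m ∧ t (j + 1) = t (i + 1) ∧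
    s(p (j + 1), t (j + 1)) ∈ M

theorem Saturates.mem_last {m : ℕ} {p t : ℕ → V} (hM : Saturates (m + 1) p t M) :
    s(p (m + 1), t (m + 1)) ∈ M := by
  obtain ⟨j, h1, h2, -, h⟩ := hM.exists_mem m (by omega)
  obtain rfl : j = m := by omega
  exact h

/-- The coloring `d` has reached the first `k` path edges and the first `l` edges leaving the
path. -/
structure Stage (G : SimpleGraph V) (m : ℕ) (p t : ℕ → V) (M : Set (Sym2 V))
    (k l : ℕ) (d : Sym2 V → Fin 8) : Prop where
  valid : Valid G d
  zero : ∀ e ∈ M, d e = 0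
  outside : ∀ a b, G.Adj a b → (∀ j, j ≤ m + 1 → a ≠ p j) → (∀ j, j ≤ m + 1 → b ≠ p j) →
    d s(a, b) = 0 → s(a, b) ∈ M
  path_ne : ∀ j, j ≤ m → j < k → d s(p j, p (j + 1)) ≠ 0
  t_ne : ∀ j, j ≤ m + 1 → j < l → s(p j, t j) ∉ M → d s(p j, t j) ≠ 0
  path_eq : ∀ j, k ≤ j → j ≤ m → d s(p j, p (j + 1)) = 0
  t_eq : ∀ j, l ≤ j → j ≤ m + 1 → d s(p j, t j) = 0

namespace Stage

variable {m k l : ℕ} {p t : ℕ → V}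

theorem good (L : Ladder G m p t) (hM : ZeroClass G M) (h : Stage G m p t M (m + 1) (m + 2) d) :
    GoodColoring G d := by
  refine good_of_valid hM h.valid fun a b hab h0 => ?_
  have key : ∀ a b, G.Adj a b → d s(a, b) = 0 → (∃ j, j ≤ m + 1 ∧ a = p j) → s(a, b) ∈ M := by
    rintro a b hab h0 ⟨j, hj, rfl⟩
    rcases L.eq_edge hj hab with he | ⟨i, hi, -, he⟩
    · rw [he] at h0 ⊢
      by_contra hc
      exact h.t_ne j hj (by omega) hc h0
    · rw [he] at h0
      exact absurd h0 (h.path_ne i hi (by omega))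
  by_cases ha : ∃ j, j ≤ m + 1 ∧ a = p j
  · exact key a b hab h0 ha
  by_cases hb : ∃ j, j ≤ m + 1 ∧ b = p j
  · rw [Sym2.eq_swap] at h0 ⊢
    exact key b a hab.symm h0 hb
  push Not at ha hb
  exact h.outside a b hab ha hb h0

section Update

variable [DecidableEq V]

theorem update_t (L : Ladder G m p t) (h : Stage G m p t M k l d) (hl : l ≤ m + 1)
    (hlM : s(p l, t l) ∉ M) {α : Fin 8} (hα : α ≠ 0)
    (hv : Valid G (Function.update d s(p l, t l) α)) :
    Stage G m p t M k (l + 1) (Function.update d s(p l, t l) α) := by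
  have hpath : ∀ j, j ≤ m → s(p j, p (j + 1)) ≠ s(p l, t l) := fun j hj =>
    (L.t_ne_path hl hj).symm
  have ht : ∀ j, j ≤ m + 1 → j ≠ l → s(p j, t j) ≠ s(p l, t l) := fun j hj hne he =>
    hne (L.t_inj hj hl he)
  refine ⟨hv, fun e he => ?_, fun a b hab ha hb h0 => ?_, fun j hj hjk => ?_,
    fun j hj hjl hjM => ?_, fun j hkj hj => ?_, fun j hlj hj => ?_⟩
  · rw [Function.update_of_ne (by rintro rfl; exact hlM he)]; exact h.zero e he
  · have hne : s(a, b) ≠ s(p l, t l) := by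
      intro he
      rcases Sym2.eq_iff.1 he with ⟨h1, _⟩ | ⟨_, h1⟩
      · exact ha l hl h1
      · exact hb l hl h1
    rw [Function.update_of_ne hne] at h0
    exact h.outside a b hab ha hb h0
  · rw [Function.update_of_ne (hpath j hj)]; exact h.path_ne j hj hjk
  · by_cases hjl' : j = l
    · subst hjl'; rw [Function.update_self]; exact hα
    · rw [Function.update_of_ne (ht j hj hjl')]; exact h.t_ne j hj (by omega) hjM
  · rw [Function.update_of_ne (hpath j hj)]; exact h.path_eq j hkj hj
  · rw [Function.update_of_ne (ht j hj (by omega))]; exact h.t_eq j (by omega) hj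

theorem update_path (L : Ladder G m p t) (h : Stage G m p t M k l d) (hk : k ≤ m)
    (hkM : s(p k, p (k + 1)) ∉ M) {α : Fin 8} (hα : α ≠ 0)
    (hv : Valid G (Function.update d s(p k, p (k + 1)) α)) :
    Stage G m p t M (k + 1) l (Function.update d s(p k, p (k + 1)) α) := by
  have ht : ∀ j, j ≤ m + 1 → s(p j, t j) ≠ s(p k, p (k + 1)) := fun j hj =>
    L.t_ne_path hj hk
  have hpath : ∀ j, j ≤ m → j ≠ k → s(p j, p (j + 1)) ≠ s(p k, p (k + 1)) := fun j hj hne he =>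
    hne (L.path_inj hj hk he)
  refine ⟨hv, fun e he => ?_, fun a b hab ha hb h0 => ?_, fun j hj hjk => ?_,
    fun j hj hjl hjM => ?_, fun j hkj hj => ?_, fun j hlj hj => ?_⟩
  · rw [Function.update_of_ne (by rintro rfl; exact hkM he)]; exact h.zero e he
  · have hne : s(a, b) ≠ s(p k, p (k + 1)) := by
      intro he
      rcases Sym2.eq_iff.1 he with ⟨h1, _⟩ | ⟨_, h1⟩
      · exact ha k (by omega) h1
      · exact hb k (by omega) h1
    rw [Function.update_of_ne hne] at h0
    exact h.outside a b hab ha hb h0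
  · by_cases hjk' : j = k
    · subst hjk'; rw [Function.update_self]; exact hα
    · rw [Function.update_of_ne (hpath j hj hjk')]; exact h.path_ne j hj (by omega)
  · rw [Function.update_of_ne (ht j hj)]; exact h.t_ne j hj hjl hjM
  · rw [Function.update_of_ne (hpath j hj (by omega))]; exact h.path_eq j (by omega) hj
  · rw [Function.update_of_ne (ht j hj)]; exact h.t_eq j hlj hj

end Update

theorem nz_eq_empty (L : Ladder G m p t) (h : Stage G m p t M k l d) {j : ℕ} (hj : j ≤ m + 1)
    (hl : l ≤ j) (hk : k < j ∨ k = 0) : nz G d (p j) = ∅ := by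
  rw [← Finset.subset_empty]
  refine L.nz_path_subset hj (fun h0 => absurd (h.t_eq j hl hj) h0) fun i hi hij h0 => ?_
  exact absurd (h.path_eq i (by omega) hi) h0

variable [Finite V]

theorem card_nz_t (hG : Subcubic G) (L : Ladder G m p t) (hM : Saturates m p t M)
    (h : Stage G m p t M k l d) {i : ℕ} (hi : i < m) : (nz G d (t (i + 1))).card ≤ 2 := by
  obtain ⟨j, -, hj, ht, hjM⟩ := hM.exists_mem i hi
  rw [← ht]
  refine card_nz_le_two hG (L.adj_t (i := j + 1) (by omega)).symm ?_
  rw [Sym2.eq_swap]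
  exact h.zero _ hjM

theorem step_t (hG : Subcubic G) (L : Ladder G m p t) (hM : Saturates m p t M)
    (h : Stage G m p t M k k d) (hk : k ≤ m) : ∃ d', Stage G m p t M k (k + 1) d' := by
  classical
  by_cases hkM : s(p k, t k) ∈ M
  · refine ⟨d, h.valid, h.zero, h.outside, h.path_ne, fun j hj hjk hjM => ?_, h.path_eq,
      fun j hkj hj => h.t_eq j (by omega) hj⟩
    have : j ≠ k := by rintro rfl; exact hjM hkM
    exact h.t_ne j hj (by omega) hjM
  have hadj := L.adj_t (i := k) (by omega)
  have hk0 := h.t_eq k le_rfl (by omega)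
  suffices ∃ α, α ≠ 0 ∧ Valid G (Function.update d s(p k, t k) α) by
    obtain ⟨α, hα, hv⟩ := this
    exact ⟨_, h.update_t L (by omega) hkM hα hv⟩
  rcases k with _ | i
  · obtain ⟨y, z, -, -, hyz⟩ := exists_two_neighbors hG hadj.symm
    have c1 := card_nz_le_three (d := d) hG y
    have c2 := card_nz_le_three (d := d) hG z
    have c3 := Finset.card_union_le (nz G d y) (nz G d z)
    have hy : nz G d y ⊆ nz G d y ∪ nz G d z := Finset.subset_union_left
    have hz : nz G d z ⊆ nz G d y ∪ nz G d z := Finset.subset_union_right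
    refine h.valid.extend hadj (nz G d y ∪ nz G d z) (by omega) (fun w hw => ?_) (fun w hw => ?_)
    · rcases (L.first w).1 hw with rfl | rfl
      · rw [h.nz_eq_empty L (by omega) (by omega) (by omega)]; simp
      · refine nz_subset fun x hx hx0 => ?_
        rcases hyz x hx with rfl | rfl | rfl
        · rw [Sym2.eq_swap] at hx0; exact absurd hk0 hx0
        · exact hy (color_mem_nz_right hx hx0)
        · exact hz (color_mem_nz_right hx hx0)
    · rcases hyz w hw with rfl | rfl | rfl
      · rw [h.nz_eq_empty L (by omega) (by omega) (by omega)]; simp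
      · exact hy
      · exact hz
  · obtain ⟨j, hij, hjm, ht, hjM⟩ := hM.exists_mem i (by omega)
    have hne : j ≠ i := by rintro rfl; exact hkM hjM
    have hadj' := (L.adj_t (i := j + 1) (by omega)).symm
    rw [ht] at hadj'
    obtain ⟨y, hy⟩ := exists_third_neighbor hG hadj.symm hadj' (fun he => hne (by
      have := L.inj _ _ (by omega) (by omega) he
      omega))
    have c1 := card_nz_le_three (d := d) hG (p i)
    have c2 := card_nz_le_three (d := d) hG y
    have c3 := Finset.card_union_le (nz G d (p i)) (nz G d y)
    have hp' : nz G d (p i) ⊆ nz G d (p i) ∪ nz G d y := Finset.subset_union_left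
    have hy' : nz G d y ⊆ nz G d (p i) ∪ nz G d y := Finset.subset_union_right
    refine h.valid.extend hadj (nz G d (p i) ∪ nz G d y) (by omega)
      (fun w hw => ?_) (fun w hw => ?_)
    · rcases (L.mid i (by omega) w).1 hw with rfl | rfl | rfl
      · exact hp'
      · rw [h.nz_eq_empty L (by omega) (by omega) (by omega)]; simp
      · refine nz_subset fun x hx hx0 => ?_
        rcases hy x hx with rfl | rfl | rfl
        · rw [Sym2.eq_swap] at hx0; exact absurd hk0 hx0
        · rw [Sym2.eq_swap, ← ht] at hx0
          exact absurd (h.zero _ hjM) hx0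
        · exact hy' (color_mem_nz_right hx hx0)
    · rcases hy w hw with rfl | rfl | rfl
      · refine L.nz_path_subset (by omega) (fun h0 => absurd hk0 h0) fun x hx hx' h0 => ?_
        rcases hx' with rfl | hx'
        · exact absurd (h.path_eq _ le_rfl hx) h0
        · obtain rfl : x = i := by omega
          exact hp' (color_mem_nz_left (L.adj_succ hx) h0)
      · rw [h.nz_eq_empty L (by omega) (by omega) (by omega)]; simp
      · exact hy'

theorem step_path (hG : Subcubic G) (L : Ladder G m p t) (hM : Saturates m p t M)
    (h : Stage G m p t M k l d) (hk : k ≤ m) (hkl : k < l) (hlk : l ≤ k + 2)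
    (h2 : (nz G d (t (k + 1))).card ≤ 2) : ∃ d', Stage G m p t M (k + 1) l d' := by
  classical
  have hadj := L.adj_succ hk
  have hk0 := h.path_eq k le_rfl hk
  suffices ∃ T : Finset (Fin 8), T.card ≤ 6 ∧ nz G d (t k) ⊆ T ∧ nz G d (t (k + 1)) ⊆ T ∧
      ∀ i, i + 1 = k → nz G d (p i) ⊆ T by
    obtain ⟨T, hT, h1, h2, h3⟩ := this
    suffices ∃ α, α ≠ 0 ∧ Valid G (Function.update d s(p k, p (k + 1)) α) by
      obtain ⟨α, hα, hv⟩ := this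
      exact ⟨_, h.update_path L hk (hM.notMem k hk) hα hv⟩
    refine h.valid.extend hadj T hT (fun z hz => ?_) (fun z hz => ?_)
    · rcases L.eq_of_adj (by omega) hz with rfl | ⟨j, hj, rfl | hjk, rfl⟩
      · exact h1
      · refine L.nz_path_subset (by omega)
          (fun h0 => h2 (color_mem_nz_right (L.adj_t (by omega)) h0)) fun i hi hi' h0 => ?_
        exact absurd (h.path_eq i (by omega) hi) h0
      · exact h3 j hjk
    · rcases L.eq_of_adj (by omega) hz with rfl | ⟨j, hj, rfl | hjk, rfl⟩
      · exact h2
      · rw [h.nz_eq_empty L (by omega) (by omega) (by omega)]; simp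
      · obtain rfl : j = k := by omega
        refine L.nz_path_subset (by omega)
          (fun h0 => h1 (color_mem_nz_right (L.adj_t (by omega)) h0)) fun i hi hi' h0 => ?_
        rcases hi' with rfl | hi'
        · exact absurd hk0 h0
        · exact h3 i hi' (color_mem_nz_left (L.adj_succ hi) h0)
  have c3 := Finset.card_union_le (nz G d (t k)) (nz G d (t (k + 1)))
  rcases k with _ | i
  · have c1 := card_nz_le_three (d := d) hG (t 0)
    exact ⟨_, by omega, Finset.subset_union_left, Finset.subset_union_right, by omega⟩
  · have c1 := h.card_nz_t hG L hM (i := i) (by omega)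
    set A := nz G d (t (i + 1)) ∪ nz G d (t (i + 1 + 1)) with hA
    have hAl : nz G d (t (i + 1)) ⊆ A := Finset.subset_union_left
    have hAr : nz G d (t (i + 1 + 1)) ⊆ A := Finset.subset_union_right
    have c4 : (nz G d (p i) \ A).card ≤ 2 := by
      have hs : (nz G d (p i) \ A).card ≤ (nz G d (p i)).card :=
        Finset.card_le_card Finset.sdiff_subset
      rcases i with _ | i
      · exact hs.trans ((card_nz_le _).trans L.ncard_first)
      · by_cases h0 : d s(p (i + 1), t (i + 1)) = 0
        · exact hs.trans (card_nz_le_two hG (L.adj_t (by omega)) h0)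
        · obtain ⟨j, hij, hjm, ht, hjM⟩ := hM.exists_mem i (by omega)
          have hne : j ≠ i := by rintro rfl; exact h0 (h.zero _ hjM)
          have hnear := L.near (i + 1) (j + 1) (by omega) (by omega) ht.symm
          have hmem := color_mem_nz_right (L.adj_t (i := i + 1) (by omega)) h0
          have hmemA : d s(p (i + 1), t (i + 1)) ∈ A := by
            rw [← ht] at hmem ⊢
            obtain rfl | rfl : j = i + 1 ∨ j = i + 2 := by omega
            · exact hAl hmem
            · exact hAr hmem
          have hmem' := color_mem_nz_left (L.adj_t (i := i + 1) (by omega)) h0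
          have hlt : (nz G d (p (i + 1)) \ A).card < (nz G d (p (i + 1))).card := by
            refine Finset.card_lt_card ⟨Finset.sdiff_subset, fun hsub => ?_⟩
            exact (Finset.mem_sdiff.1 (hsub hmem')).2 hmemA
          have := card_nz_le_three (d := d) hG (p (i + 1))
          omega
    have c5 := Finset.card_union_le A (nz G d (p i) \ A)
    refine ⟨A ∪ (nz G d (p i) \ A), by omega, hAl.trans Finset.subset_union_left,
      hAr.trans Finset.subset_union_left, fun j hj => ?_⟩
    obtain rfl : j = i := by omega
    intro x hx
    by_cases hxA : x ∈ A <;> simp [hx, hxA]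

theorem run (hG : Subcubic G) (L : Ladder G m p t) (hM : Saturates m p t M)
    (h : Stage G m p t M 0 0 d) : ∀ k, k ≤ m → ∃ d', Stage G m p t M k k d'
  | 0, _ => ⟨d, h⟩
  | k + 1, hk => by
    obtain ⟨d₁, h₁⟩ := run hG L hM h k (by omega)
    obtain ⟨d₂, h₂⟩ := h₁.step_t hG L hM (by omega)
    exact h₂.step_path hG L hM (by omega) (by omega) (by omega) (h₂.card_nz_t hG L hM (by omega))

theorem run_last (hG : Subcubic G) (L : Ladder G m p t) (hM : Saturates m p t M)
    (h : Stage G m p t M 0 0 d) : ∃ d', Stage G m p t M (m + 1) (m + 1) d' := by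
  obtain ⟨d₁, h₁⟩ := h.run hG L hM m le_rfl
  obtain ⟨d₂, h₂⟩ := h₁.step_t hG L hM le_rfl
  refine h₂.step_path hG L hM le_rfl (by omega) (by omega) ?_
  refine card_nz_le_two hG (L.adj_t (i := m + 1) le_rfl).symm ?_
  rw [Sym2.eq_swap]
  exact h₂.t_eq _ le_rfl le_rfl

end Stage

/-- The path edges `s(p (j + 1), t (j + 1))` at inner vertices, keeping only the last one at each
off-path vertex. -/
def rungs (m : ℕ) (p t : ℕ → V) : Set (Sym2 V) :=
  {e | ∃ j, j < m ∧ (∀ i, j < i → i < m → t (i + 1) ≠ t (j + 1)) ∧ e = s(p (j + 1), t (j + 1))}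

namespace Avoids

variable {m : ℕ} {p t : ℕ → V}

theorem zeroClass_rungs (L : Ladder G m p t) (h : Avoids G {x | ∃ j ≤ m + 1, x = p j} M d) :
    ZeroClass G (M ∪ rungs m p t) := by
  have hadj : ∀ j, j < m → G.Adj (p (j + 1)) (t (j + 1)) := fun j hj => L.adj_t (by omega)
  have hp : ∀ j, j < m → ∀ b, s(p (j + 1), b) ∉ M := fun j hj =>
    h.notMem _ ⟨j + 1, by omega, rfl⟩
  have ht : ∀ j, j < m → ∀ b, s(t (j + 1), b) ∉ M := fun j hj =>
    h.notMem_of_adj _ ⟨j + 1, by omega, rfl⟩ _ (hadj j hj)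
  refine ⟨?_, ?_, ?_⟩
  · rintro a b (hab | ⟨j, hj, -, he⟩)
    · exact h.zeroClass.adj _ _ hab
    · rcases Sym2.eq_iff.1 he with ⟨rfl, rfl⟩ | ⟨rfl, rfl⟩
      exacts [hadj j hj, (hadj j hj).symm]
  · rintro a b (hab | ⟨j, hj, -, he⟩)
    · exact h.zeroClass.deg _ _ hab
    · rcases Sym2.eq_iff.1 he with ⟨rfl, rfl⟩ | ⟨rfl, rfl⟩
      exacts [L.deg_p j hj, L.deg_t j hj]
  · rintro a b c (hb | ⟨j, hj, hjm, he⟩) (hc | ⟨i, hi, him, he'⟩)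
    · exact h.zeroClass.unique _ _ _ hb hc
    · rcases Sym2.eq_iff.1 he' with ⟨rfl, rfl⟩ | ⟨rfl, rfl⟩
      exacts [absurd hb (hp i hi _), absurd hb (ht i hi _)]
    · rcases Sym2.eq_iff.1 he with ⟨rfl, rfl⟩ | ⟨rfl, rfl⟩
      exacts [absurd hc (hp j hj _), absurd hc (ht j hj _)]
    · rcases Sym2.eq_iff.1 he with ⟨rfl, rfl⟩ | ⟨rfl, rfl⟩ <;>
      rcases Sym2.eq_iff.1 he' with ⟨h1, rfl⟩ | ⟨h1, rfl⟩
      · rw [L.inj _ _ (by omega) (by omega) h1]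
      · exact absurd h1.symm (L.off _ _ (by omega) (by omega))
      · exact absurd h1 (L.off _ _ (by omega) (by omega))
      · rcases lt_trichotomy j i with hlt | rfl | hlt
        · exact absurd h1.symm (hjm i hlt hi)
        · rfl
        · exact absurd h1 (him j hlt hj)

theorem saturates_rungs (L : Ladder G m p t) (h : Avoids G {x | ∃ j ≤ m + 1, x = p j} M d) :
    Saturates m p t (M ∪ rungs m p t) := by
  classical
  refine ⟨?_, ?_, fun i hi => ?_⟩
  · rintro j hj (h' | ⟨i, hi, -, he⟩)
    · exact h.notMem _ ⟨j, by omega, rfl⟩ _ h'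
    · exact L.t_ne_path (by omega) hj he.symm
  · rintro (h' | ⟨i, hi, -, he⟩)
    · exact h.notMem _ ⟨m + 1, le_rfl, rfl⟩ _ h'
    · have := L.t_inj le_rfl (by omega) he
      omega
  · let P : ℕ → Prop := fun j => t (j + 1) = t (i + 1)
    have hP : P (Nat.findGreatest P (m - 1)) := Nat.findGreatest_spec (m := i) (by omega) rfl
    have hle := Nat.findGreatest_le (P := P) (m - 1)
    refine ⟨_, Nat.le_findGreatest (P := P) (m := i) (by omega) rfl, by omega, hP,
      Or.inr ⟨_, by omega, fun j hj hjm he => ?_, rfl⟩⟩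
    exact Nat.findGreatest_is_greatest hj (by omega) (he.trans hP)

theorem stage_rungs (L : Ladder G m p t) (h : Avoids G {x | ∃ j ≤ m + 1, x = p j} M d) :
    Stage G m p t (M ∪ rungs m p t) 0 0 d := by
  refine ⟨h.valid, ?_, fun a b hab ha hb h0 => Or.inl (h.outside a b hab ?_ ?_ h0), by omega,
    by omega, fun j _ hj => ?_, fun j _ hj => ?_⟩
  · rintro e (he | ⟨j, hj, -, rfl⟩)
    · exact h.zero e he
    · exact h.inside _ _ (L.adj_t (by omega)) ⟨j + 1, by omega, rfl⟩
  · rintro ⟨j, hj, he⟩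
    exact ha j hj he
  · rintro ⟨j, hj, he⟩
    exact hb j hj he
  · exact h.inside _ _ (L.adj_succ hj) ⟨j, by omega, rfl⟩
  · exact h.inside _ _ (L.adj_t hj) ⟨j, hj, rfl⟩

end Avoids

theorem Saturates.insert {m : ℕ} {p t : ℕ → V} (L : Ladder G m p t) (hM : Saturates m p t M)
    {y : V} (hy : y ≠ p (m + 1)) : Saturates m p t (insert s(t (m + 1), y) M) := by
  refine ⟨?_, ?_, fun i hi => ?_⟩
  · rintro j hj (h | h)
    · rcases Sym2.eq_iff.1 h with ⟨h, -⟩ | ⟨-, h⟩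
      · exact L.off _ _ le_rfl (by omega) h.symm
      · exact L.off _ _ le_rfl (by omega) h.symm
    · exact hM.notMem j hj h
  · rintro (h | h)
    · rcases Sym2.eq_iff.1 h with ⟨h, -⟩ | ⟨h, -⟩
      · exact L.off _ _ le_rfl le_rfl h.symm
      · exact hy h.symm
    · exact hM.last_notMem h
  · obtain ⟨j, h1, h2, h3, h4⟩ := hM.exists_mem i hi
    exact ⟨j, h1, h2, h3, Or.inr h4⟩

namespace Stage

variable {m k : ℕ} {p t : ℕ → V}

theorem insert [DecidableEq V] (h : Stage G m p t M 0 0 d) {x y : V} (hxy : G.Adj x y) :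
    Stage G m p t (insert s(x, y) M) 0 0 (Function.update d s(x, y) 0) := by
  have key : ∀ e, d e = 0 → Function.update d s(x, y) 0 e = 0 := by
    intro e he
    rw [Function.update_apply]
    split <;> simp [he]
  refine ⟨h.valid.update_zero hxy, ?_, fun a b hab ha hb h0 => ?_, by omega,
    by omega, fun j h0 hj => key _ (h.path_eq j h0 hj), fun j h0 hj => key _ (h.t_eq j h0 hj)⟩
  · rintro e (rfl | he)
    · exact Function.update_self _ _ _
    · exact key e (h.zero e he)
  · by_cases he : s(a, b) = s(x, y)
    · exact Or.inl he
    · rw [Function.update_of_ne he] at h0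
      exact Or.inr (h.outside a b hab ha hb h0)

theorem step_last (L : Ladder G m p t) (hM : Saturates m p t M) (h : Stage G m p t M k (m + 1) d)
    (T : Finset (Fin 8)) (hT : T.card ≤ 6) (hp : nz G d (p m) ⊆ T)
    (ht : ∀ z, G.Adj (t (m + 1)) z → z ≠ p (m + 1) → nz G d z ⊆ T) :
    ∃ d', Stage G m p t M k (m + 2) d' := by
  classical
  have hadj := L.adj_t (i := m + 1) le_rfl
  have h0 := h.t_eq (m + 1) le_rfl le_rfl
  suffices ∃ α, α ≠ 0 ∧ Valid G (Function.update d s(p (m + 1), t (m + 1)) α) by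
    obtain ⟨α, hα, hv⟩ := this
    exact ⟨_, h.update_t L le_rfl hM.last_notMem hα hv⟩
  refine h.valid.extend hadj T hT (fun z hz => ?_) (fun z hz => ?_)
  · rcases (L.last z).1 hz with rfl | rfl
    · exact hp
    · refine nz_subset fun w hw hw0 => ?_
      by_cases hwp : w = p (m + 1)
      · subst hwp
        rw [Sym2.eq_swap] at hw0
        exact absurd h0 hw0
      · exact ht w hw hwp (color_mem_nz_right hw hw0)
  · by_cases hzp : z = p (m + 1)
    · subst hzp
      refine nz_subset fun w hw hw0 => ?_
      rcases (L.last w).1 hw with rfl | rfl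
      · exact hp (color_mem_nz_right hw hw0)
      · exact absurd h0 hw0
    · exact ht z hz hzp

variable [Finite V]

theorem step_last_of_eq (hG : Subcubic G) (L : Ladder G m p t) (hM : Saturates m p t M)
    (h : Stage G m p t M k (m + 1) d) {j : ℕ} (hj : j < m) (ht : t (j + 1) = t (m + 1))
    (hjM : s(p (j + 1), t (j + 1)) ∈ M) : ∃ d', Stage G m p t M k (m + 2) d' := by
  have hadj := L.adj_t (i := m + 1) le_rfl
  have hadj' := L.adj_t (i := j + 1) (by omega)
  rw [ht] at hadj'
  obtain ⟨y, hy⟩ := exists_third_neighbor hG hadj.symm hadj'.symm fun he => by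
    have := L.inj _ _ le_rfl (by omega) he
    omega
  have c1 : (nz G d (p m) ∪ nz G d (p (j + 1))).card ≤ 3 := by
    have := L.near (j + 1) (m + 1) (by omega) le_rfl ht
    obtain rfl | rfl : m = j + 1 ∨ m = j + 2 := by omega
    · rw [Finset.union_self]
      exact card_nz_le_three hG _
    · refine (Finset.card_le_card (Finset.union_subset
        (L.nz_path_subset (by omega) (fun h0 => absurd (h.zero _ hM.mem_last) h0) ?_)
        (L.nz_path_subset (by omega) (fun h0 => absurd (h.zero _ hjM) h0) ?_))).trans
        (Finset.card_le_three (a := d s(p j, p (j + 1))) (b := d s(p (j + 1), p (j + 1 + 1)))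
          (c := d s(p (j + 2), p (j + 2 + 1))))
      · intro i _ hi _
        obtain rfl | rfl : i = j + 1 ∨ i = j + 2 := by omega
        all_goals simp
      · intro i _ hi _
        obtain rfl | rfl : i = j ∨ i = j + 1 := by omega
        all_goals simp
  have c2 := card_nz_le_three (d := d) hG y
  have c3 := Finset.card_union_le (nz G d (p m) ∪ nz G d (p (j + 1))) (nz G d y)
  refine h.step_last L hM (nz G d (p m) ∪ nz G d (p (j + 1)) ∪ nz G d y) (by omega)
    (Finset.subset_union_left.trans Finset.subset_union_left) fun z hz hzp => ?_
  rcases hy z hz with rfl | rfl | rfl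
  · exact absurd rfl hzp
  · exact Finset.subset_union_right.trans Finset.subset_union_left
  · exact Finset.subset_union_right

theorem finish_of_mem (hG : Subcubic G) (L : Ladder G m p t) (hM : Saturates m p t M)
    (h : Stage G m p t M 0 0 d) {y : V} (hy : y ≠ p (m + 1)) (hadj : G.Adj (t (m + 1)) y)
    (hyM : s(t (m + 1), y) ∈ M) : ∃ d', Stage G m p t M (m + 1) (m + 2) d' := by
  obtain ⟨d₁, h₁⟩ := h.run hG L hM m le_rfl
  obtain ⟨d₂, h₂⟩ := h₁.step_t hG L hM le_rfl
  obtain ⟨x, hx⟩ := exists_third_neighbor hG (L.adj_t le_rfl).symm hadj hy.symm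
  have hem := h₂.path_eq m le_rfl le_rfl
  have c1 : (nz G d₂ (p m)).card ≤ 1 := by
    rcases m with _ | n
    · refine (Finset.card_le_card (L.nz_path_subset (T := {d₂ s(p 0, t 0)}) (by omega) (by simp)
        fun j hj _ h0 => ?_)).trans (Finset.card_singleton _).le
      obtain rfl : j = 0 := by omega
      exact absurd hem h0
    · refine (Finset.card_le_card (L.nz_path_subset (T := {d₂ s(p n, p (n + 1))}) (by omega)
        (fun h0 => absurd (h₂.zero _ hM.mem_last) h0)
        fun j hj hj' h0 => ?_)).trans (Finset.card_singleton _).le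
      rcases hj' with rfl | hj'
      · exact absurd hem h0
      · obtain rfl : j = n := by omega
        simp
  have c2 : (nz G d₂ y).card ≤ 2 := card_nz_le_two hG hadj.symm (by
    rw [Sym2.eq_swap]
    exact h₂.zero _ hyM)
  have c3 := card_nz_le_three (d := d₂) hG x
  have c4 := Finset.card_union_le (nz G d₂ (p m) ∪ nz G d₂ y) (nz G d₂ x)
  have c5 := Finset.card_union_le (nz G d₂ (p m)) (nz G d₂ y)
  obtain ⟨d₃, h₃⟩ := h₂.step_last L hM (nz G d₂ (p m) ∪ nz G d₂ y ∪ nz G d₂ x) (by omega)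
    (Finset.subset_union_left.trans Finset.subset_union_left) fun z hz hzp => by
      rcases hx z hz with rfl | rfl | rfl
      · exact absurd rfl hzp
      · exact Finset.subset_union_right.trans Finset.subset_union_left
      · exact Finset.subset_union_right
  exact h₃.step_path hG L hM le_rfl (by omega) (by omega)
    (card_nz_le_two hG hadj (h₃.zero _ hyM))

theorem finish_of_le_two (hG : Subcubic G) (L : Ladder G m p t) (hM : Saturates m p t M)
    (h : Stage G m p t M (m + 1) (m + 1) d)
    (h2 : (G.neighborSet (t (m + 1))).ncard = 3 →
      ∀ y, G.Adj (t (m + 1)) y → y ≠ p (m + 1) → (nz G d y).card ≤ 2) :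
    ∃ d', Stage G m p t M (m + 1) (m + 2) d' := by
  have hadj := (L.adj_t (i := m + 1) le_rfl).symm
  by_cases h3 : (G.neighborSet (t (m + 1))).ncard = 3
  · obtain ⟨y, z, hy, hz, hyz⟩ := exists_two_neighbors hG hadj
    have key : ∀ y, G.Adj (t (m + 1)) y → (nz G d y).card ≤ 2 := by
      intro y hy
      by_cases hyp : y = p (m + 1)
      · subst hyp
        exact card_nz_le_two hG hadj.symm (h.t_eq _ le_rfl le_rfl)
      · exact h2 h3 y hy hyp
    have c1 : (nz G d (p m)).card ≤ 2 := by
      rcases m with _ | n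
      · exact (card_nz_le _).trans L.ncard_first
      · exact card_nz_le_two hG (L.adj_t (by omega)) (h.zero _ hM.mem_last)
    have c2 := key y hy
    have c3 := key z hz
    have c4 := Finset.card_union_le (nz G d (p m) ∪ nz G d y) (nz G d z)
    have c5 := Finset.card_union_le (nz G d (p m)) (nz G d y)
    refine h.step_last L hM (nz G d (p m) ∪ nz G d y ∪ nz G d z) (by omega)
      (Finset.subset_union_left.trans Finset.subset_union_left) fun w hw hwp => ?_
    rcases hyz w hw with rfl | rfl | rfl
    · exact absurd rfl hwp
    · exact Finset.subset_union_right.trans Finset.subset_union_left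
    · exact Finset.subset_union_right
  · have := hG (t (m + 1))
    obtain ⟨y, hy⟩ := exists_other_neighbor (by omega) hadj
    have c1 := card_nz_le_three (d := d) hG (p m)
    have c2 := card_nz_le_three (d := d) hG y
    have c3 := Finset.card_union_le (nz G d (p m)) (nz G d y)
    refine h.step_last L hM (nz G d (p m) ∪ nz G d y) (by omega) Finset.subset_union_left
      fun w hw hwp => ?_
    rcases hy w hw with rfl | rfl
    · exact absurd rfl hwp
    · exact Finset.subset_union_right

end Stage

theorem not_ladder [Finite V] (hG : MinCounter V G) {m : ℕ} {p t : ℕ → V} :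
    ¬ Ladder G m p t := by
  classical
  intro L
  obtain ⟨M₀, d₀, h₀⟩ := exists_avoids hG (X := {x | ∃ j ≤ m + 1, x = p j})
    ⟨0, by omega, rfl⟩ (L.adj_t (i := 0) (by omega))
  have hZ := h₀.zeroClass_rungs L
  have hM := h₀.saturates_rungs L
  have h := h₀.stage_rungs L
  have hadj := L.adj_t (i := m + 1) le_rfl
  by_cases hA : ∃ x, s(t (m + 1), x) ∈ M₀ ∪ rungs m p t
  · obtain ⟨x, hx | ⟨j, hj, hjm, he⟩⟩ := hA
    · exact h₀.notMem_of_adj _ ⟨m + 1, le_rfl, rfl⟩ _ hadj _ hx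
    · rcases Sym2.eq_iff.1 he with ⟨he, -⟩ | ⟨he, -⟩
      · exact L.off _ _ le_rfl (by omega) he
      · obtain ⟨d₁, h₁⟩ := h.run_last hG.1 L hM
        obtain ⟨d₂, h₂⟩ := h₁.step_last_of_eq hG.1 L hM hj he.symm (Or.inr ⟨j, hj, hjm, rfl⟩)
        exact hG.2.1 ⟨d₂, h₂.good L hZ⟩
  push Not at hA
  by_cases hB : (G.neighborSet (t (m + 1))).ncard = 3 ∧ ∃ y, y ≠ p (m + 1) ∧
      G.Adj (t (m + 1)) y ∧ (G.neighborSet y).ncard = 3 ∧ ∀ x, s(y, x) ∉ M₀ ∪ rungs m p t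
  · obtain ⟨h3, y, hyp, hy, hy3, hyM⟩ := hB
    obtain ⟨d₁, h₁⟩ := (h.insert hy).finish_of_mem hG.1 L (hM.insert L hyp) hyp hy (Or.inl rfl)
    exact hG.2.1 ⟨d₁, h₁.good L (hZ.insert hy h3 hy3 hA hyM)⟩
  · obtain ⟨d₁, h₁⟩ := h.run_last hG.1 L hM
    obtain ⟨d₂, h₂⟩ := h₁.finish_of_le_two hG.1 L hM fun h3 y hy hyp => by
      by_cases hy3 : (G.neighborSet y).ncard = 3
      · obtain ⟨x, hx⟩ : ∃ x, s(y, x) ∈ M₀ ∪ rungs m p t := by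
          by_contra! hyM
          exact hB ⟨h3, y, hyp, hy, hy3, hyM⟩
        exact card_nz_le_two hG.1 (hZ.adj _ _ hx) (h₁.zero _ hx)
      · have := hG.1 y
        exact (card_nz_le y).trans (by omega)
    exact hG.2.1 ⟨d₂, h₂.good L hZ⟩

theorem nz_congr {d' : Sym2 V → Fin 8} {v : V} (h : ∀ w, G.Adj v w → d' s(v, w) = d s(v, w)) :
    nz G d' v = nz G d v := by
  ext α
  simp only [mem_nz]
  exact and_congr_right fun _ => exists_congr fun w => and_congr_right fun hw => by rw [h w hw]

namespace Avoids

variable {X : Set V}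

theorem update [DecidableEq V] (h : Avoids G X M d) {a b : V} (ha : a ∉ X) (hb : b ∉ X)
    (hM : s(a, b) ∉ M) {α : Fin 8} (hα : α ≠ 0) (hv : Valid G (Function.update d s(a, b) α)) :
    Avoids G X M (Function.update d s(a, b) α) := by
  refine ⟨h.zeroClass, hv, fun e he => ?_, fun u v huv hu => ?_, fun u v huv hu hv' h0 => ?_,
    h.notMem, h.notMem_of_adj⟩
  · rw [Function.update_of_ne (by rintro rfl; exact hM he)]
    exact h.zero e he
  · rw [Function.update_of_ne]
    · exact h.inside u v huv hu
    · intro he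
      rcases Sym2.eq_iff.1 he with ⟨rfl, -⟩ | ⟨rfl, -⟩
      exacts [ha hu, hb hu]
  · have hne : s(u, v) ≠ s(a, b) := by
      intro he
      rw [he, Function.update_self] at h0
      exact hα h0
    rw [Function.update_of_ne hne] at h0
    exact h.outside u v huv hu hv' h0

theorem insert [DecidableEq V] (h : Avoids G X M d) {a b : V} (hab : G.Adj a b) (ha : a ∉ X)
    (hb : b ∉ X) (ha' : ∀ x ∈ X, ¬ G.Adj x a) (hb' : ∀ x ∈ X, ¬ G.Adj x b)
    (hM : ZeroClass G (insert s(a, b) M)) :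
    Avoids G X (insert s(a, b) M) (Function.update d s(a, b) 0) := by
  have key : ∀ e, d e = 0 → Function.update d s(a, b) 0 e = 0 := by
    intro e he
    rw [Function.update_apply]
    split <;> simp [he]
  refine ⟨hM, h.valid.update_zero hab, ?_, fun u v huv hu => key _ (h.inside u v huv hu),
    fun u v huv hu hv h0 => ?_, ?_, ?_⟩
  · rintro e (rfl | he)
    · exact Function.update_self _ _ _
    · exact key e (h.zero e he)
  · by_cases he : s(u, v) = s(a, b)
    · exact Or.inl he
    · rw [Function.update_of_ne he] at h0
      exact Or.inr (h.outside u v huv hu hv h0)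
  · rintro x hx v (he | he)
    · rcases Sym2.eq_iff.1 he with ⟨rfl, -⟩ | ⟨rfl, -⟩
      exacts [ha hx, hb hx]
    · exact h.notMem x hx v he
  · rintro x hx u hxu v (he | he)
    · rcases Sym2.eq_iff.1 he with ⟨rfl, -⟩ | ⟨rfl, -⟩
      exacts [ha' x hx hxu, hb' x hx hxu]
    · exact h.notMem_of_adj x hx u hxu v he

end Avoids

theorem exists_ne_ne (i j : Fin 3) : ∃ k, i ≠ k ∧ j ≠ k := by
  decide +revert

/-- A vertex `y` with three neighbors `x i` of degree 2, whose other neighbors `a i` have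
degree 3. -/
structure Claw (G : SimpleGraph V) (y : V) (x a : Fin 3 → V) : Prop where
  center : ∀ z, G.Adj y z ↔ ∃ i, z = x i
  leg : ∀ i z, G.Adj (x i) z ↔ z = y ∨ z = a i
  inj : ∀ i j, x i = x j → i = j
  ne_center : ∀ i, a i ≠ y
  deg_a : ∀ i, (G.neighborSet (a i)).ncard = 3

namespace Claw

variable {y : V} {x a : Fin 3 → V} (C : Claw G y x a)
include C

theorem adj_center (i : Fin 3) : G.Adj y (x i) := (C.center _).2 ⟨i, rfl⟩

theorem adj_leg (i : Fin 3) : G.Adj (x i) (a i) := (C.leg i _).2 (Or.inr rfl)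

theorem ncard_ne_three (i : Fin 3) : (G.neighborSet (x i)).ncard ≠ 3 := by
  have : G.neighborSet (x i) = {y, a i} := by ext z; simp [C.leg]
  rw [this, Set.ncard_pair (C.ne_center i).symm]
  omega

theorem ne_leaf {v : V} (hv : (G.neighborSet v).ncard = 3) (i : Fin 3) : v ≠ x i := by
  rintro rfl
  exact C.ncard_ne_three i hv

theorem not_adj_center {v : V} (hv : (G.neighborSet v).ncard = 3) : ¬ G.Adj y v := fun h => by
  obtain ⟨i, hi⟩ := (C.center v).1 h
  exact C.ne_leaf hv i hi

theorem center_ne_leg (i j : Fin 3) : s(x i, a i) ≠ s(y, x j) := by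
  intro h
  rcases Sym2.eq_iff.1 h with ⟨h, -⟩ | ⟨-, h⟩
  · exact (C.adj_center i).ne h.symm
  · exact C.ne_center i h

theorem center_inj {i j : Fin 3} (h : s(y, x i) = s(y, x j)) : i = j :=
  C.inj i j (Sym2.congr_right.1 h)

theorem leg_notMem (hM : ZeroClass G M) (i : Fin 3) : s(x i, a i) ∉ M := fun h =>
  C.ncard_ne_three i (hM.deg _ _ h)

theorem leg_ne_zero (h : Avoids G {y} M d) (i : Fin 3) : d s(x i, a i) ≠ 0 := fun h0 =>
  C.leg_notMem h.zeroClass i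
    (h.outside _ _ (C.adj_leg i) (C.adj_center i).ne' (C.ne_center i) h0)

theorem leg_mem_nz (h : Avoids G {y} M d) (i : Fin 3) : d s(x i, a i) ∈ nz G d (a i) :=
  color_mem_nz_right (C.adj_leg i) (C.leg_ne_zero h i)

/-- Coloring an edge at the center. -/
theorem step (hd : Valid G d) (i : Fin 3) (T : Finset (Fin 8)) (hT : T.card ≤ 6)
    (hc : ∀ j, d s(y, x j) ≠ 0 → d s(y, x j) ∈ T) (hl : ∀ j, d s(x j, a j) ∈ T)
    (ha : nz G d (a i) ⊆ T) :
    ∃ d', Valid G d' ∧ d' s(y, x i) ≠ 0 ∧ ∀ e, e ≠ s(y, x i) → d' e = d e := by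
  classical
  obtain ⟨α, hα, hv⟩ : ∃ α, α ≠ 0 ∧ Valid G (Function.update d s(y, x i) α) := by
    refine hd.extend (C.adj_center i) T hT (fun z hz => ?_) (fun z hz => ?_)
    · obtain ⟨j, rfl⟩ := (C.center z).1 hz
      refine nz_subset fun w hw h0 => ?_
      rcases (C.leg j w).1 hw with rfl | rfl
      · rw [Sym2.eq_swap] at h0 ⊢
        exact hc j h0
      · exact hl j
    · rcases (C.leg i z).1 hz with rfl | rfl
      · refine nz_subset fun w hw h0 => ?_
        obtain ⟨j, rfl⟩ := (C.center w).1 hw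
        exact hc j h0
      · exact ha
  exact ⟨_, hv, by rwa [Function.update_self], fun e he => Function.update_of_ne he _ _⟩

theorem nz_eq {d' : Sym2 V → Fin 8} {j : Fin 3} (h : ∀ e, e ≠ s(y, x j) → d' e = d e)
    (i : Fin 3) : nz G d' (a i) = nz G d (a i) :=
  nz_congr fun w _ => h _ fun he => by
    rcases Sym2.eq_iff.1 he with ⟨he, -⟩ | ⟨he, -⟩
    exacts [C.ne_center i he, C.ne_leaf (C.deg_a i) j he]

/-- Recoloring the edge `s(x k, a k)`. -/
theorem recolor (h : Avoids G {y} M d) {σ : Fin 8} (hσ : σ ≠ 0) (k : Fin 3)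
    (hk : ∀ w, G.Adj (a k) w → w ≠ x k → σ ∉ nz G d w) :
    ∃ d', Avoids G {y} M d' ∧ d' s(x k, a k) = σ ∧ ∀ e, e ≠ s(x k, a k) → d' e = d e := by
  classical
  refine ⟨_, h.update (C.adj_center k).ne' (C.ne_center k) (C.leg_notMem h.zeroClass k) hσ
    (h.valid.update (C.adj_leg k) ?_), Function.update_self _ _ _,
    fun e he => Function.update_of_ne he _ _⟩
  intro _ z w hz hzw hne he
  have hmem : σ ∈ nz G d z := mem_nz.2 ⟨hσ, w, hzw, he⟩
  have hmem' : σ ∈ nz G d w := by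
    rw [Sym2.eq_swap] at he
    exact mem_nz.2 ⟨hσ, z, hzw.symm, he⟩
  have hy : ∀ w, G.Adj y w → d s(y, w) ≠ σ := fun w hw hwσ =>
    hσ (hwσ ▸ h.inside y w hw rfl)
  rcases hz with hz | hz
  · rcases (C.leg k z).1 hz with rfl | rfl
    · exact hy w hzw he
    · refine hk w hzw ?_ hmem'
      rintro rfl
      exact hne Sym2.eq_swap
  · by_cases hzx : z = x k
    · subst hzx
      rcases (C.leg k w).1 hzw with rfl | rfl
      · rw [Sym2.eq_swap] at he
        exact hy _ hzw.symm he
      · exact hne rfl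
    · exact hk z hz hzx hmem

variable [Finite V]

theorem four_lt (hG : MinCounter V G) (h : Avoids G {y} M d) {i j k : Fin 3} (hij : i ≠ j)
    (hik : i ≠ k) (hjk : j ≠ k) :
    4 < (insert (d s(x i, a i)) (insert (d s(x j, a j)) (nz G d (a k)))).card := by
  by_contra! h4
  have hall : ∀ l, l = i ∨ l = j ∨ l = k := by omega
  have hc : ∀ l, d s(y, x l) = 0 := fun l => h.inside _ _ (C.adj_center l) rfl
  have ci := card_nz_le_three (d := d) hG.1 (a i)
  have cj := card_nz_le_three (d := d) hG.1 (a j)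
  obtain ⟨d₁, hv₁, h₁, e₁⟩ := C.step h.valid i
    (insert (d s(x j, a j)) (insert (d s(x k, a k)) (nz G d (a i))))
    ((Finset.card_insert_le _ _).trans (by
      have := Finset.card_insert_le (d s(x k, a k)) (nz G d (a i))
      omega))
    (fun l h0 => absurd (hc l) h0)
    (fun l => by
      rcases hall l with rfl | rfl | rfl
      · simp [C.leg_mem_nz h]
      · simp
      · simp)
    (by intro α; simp +contextual)
  have l₁ : ∀ l, d₁ s(x l, a l) = d s(x l, a l) := fun l => e₁ _ (C.center_ne_leg l i)
  have c₁ : ∀ l, l ≠ i → d₁ s(y, x l) = 0 := fun l hl => by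
    rw [e₁ _ fun he => hl (C.center_inj he), hc]
  obtain ⟨d₂, hv₂, h₂, e₂⟩ := C.step hv₁ j
    (insert (d₁ s(y, x i)) (insert (d s(x i, a i)) (insert (d s(x k, a k)) (nz G d (a j)))))
    ((Finset.card_insert_le _ _).trans (by
      have := Finset.card_insert_le (d s(x k, a k)) (nz G d (a j))
      have := Finset.card_insert_le (d s(x i, a i)) (insert (d s(x k, a k)) (nz G d (a j)))
      omega))
    (fun l h0 => by
      by_cases hl : l = i
      · subst hl; simp
      · exact absurd (c₁ l hl) h0)
    (fun l => by
      rw [l₁]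
      rcases hall l with rfl | rfl | rfl
      · simp
      · simp [C.leg_mem_nz h]
      · simp)
    (by rw [C.nz_eq e₁]; intro α; simp +contextual)
  have l₂ : ∀ l, d₂ s(x l, a l) = d s(x l, a l) := fun l => by
    rw [e₂ _ (C.center_ne_leg l j), l₁]
  have c₂ : ∀ l, l ≠ j → d₂ s(y, x l) = d₁ s(y, x l) := fun l hl =>
    e₂ _ fun he => hl (C.center_inj he)
  obtain ⟨d₃, hv₃, h₃, e₃⟩ := C.step hv₂ k
    (insert (d₁ s(y, x i)) (insert (d₂ s(y, x j))
      (insert (d s(x i, a i)) (insert (d s(x j, a j)) (nz G d (a k))))))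
    ((Finset.card_insert_le _ _).trans (by
      have := Finset.card_insert_le (d₂ s(y, x j))
        (insert (d s(x i, a i)) (insert (d s(x j, a j)) (nz G d (a k))))
      omega))
    (fun l h0 => by
      rcases hall l with rfl | rfl | rfl
      · rw [c₂ _ hij]; simp
      · simp
      · rw [c₂ _ hjk.symm, c₁ _ hik.symm] at h0
        exact absurd rfl h0)
    (fun l => by
      rw [l₂]
      rcases hall l with rfl | rfl | rfl
      · simp
      · simp
      · simp [C.leg_mem_nz h])
    (by rw [C.nz_eq e₂, C.nz_eq e₁]; intro α; simp +contextual)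
  have key : ∀ l, d₃ s(y, x l) ≠ 0 := fun l => by
    rcases hall l with rfl | rfl | rfl
    · rwa [e₃ _ fun he => hik (C.center_inj he), c₂ _ hij]
    · rwa [e₃ _ fun he => hjk (C.center_inj he)]
    · exact h₃
  refine false_of_valid hG h.zeroClass hv₃ fun u v huv h0 => ?_
  have hu : u ≠ y := by
    rintro rfl
    obtain ⟨l, rfl⟩ := (C.center v).1 huv
    exact key l h0
  have hv : v ≠ y := by
    rintro rfl
    obtain ⟨l, rfl⟩ := (C.center u).1 huv.symm
    rw [Sym2.eq_swap] at h0
    exact key l h0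
  have hne : ∀ l, s(u, v) ≠ s(y, x l) := fun l he => by
    rcases Sym2.eq_iff.1 he with ⟨he, -⟩ | ⟨-, he⟩
    exacts [hu he, hv he]
  rw [e₃ _ (hne _), e₂ _ (hne _), e₁ _ (hne _)] at h0
  exact h.outside u v huv hu hv h0

theorem card_nz_eq_three (hG : MinCounter V G) (h : Avoids G {y} M d) (k : Fin 3) :
    (nz G d (a k)).card = 3 := by
  obtain ⟨i, hki, -⟩ := exists_ne_ne k k
  obtain ⟨j, hkj, hij⟩ := exists_ne_ne k i
  have := C.four_lt hG h hij hki.symm hkj.symm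
  have := Finset.card_insert_le (d s(x j, a j)) (nz G d (a k))
  have := Finset.card_insert_le (d s(x i, a i)) (insert (d s(x j, a j)) (nz G d (a k)))
  have := card_nz_le_three (d := d) hG.1 (a k)
  omega

theorem color_leg_ne (hG : MinCounter V G) (h : Avoids G {y} M d) {i j : Fin 3} (hij : i ≠ j) :
    d s(x i, a i) ≠ d s(x j, a j) := by
  intro he
  obtain ⟨k, hik, hjk⟩ := exists_ne_ne i j
  have h4 := C.four_lt hG h hij hik hjk
  rw [he, Finset.insert_idem] at h4
  have := Finset.card_insert_le (d s(x j, a j)) (nz G d (a k))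
  have := card_nz_le_three (d := d) hG.1 (a k)
  omega

theorem color_leg_notMem (hG : MinCounter V G) (h : Avoids G {y} M d) {i k : Fin 3}
    (hik : i ≠ k) : d s(x i, a i) ∉ nz G d (a k) := by
  intro he
  obtain ⟨j, hij, hjk⟩ := exists_ne_ne i k
  have h4 := C.four_lt hG h hij hik hjk.symm
  rw [Finset.insert_eq_of_mem (Finset.mem_insert_of_mem he)] at h4
  have := Finset.card_insert_le (d s(x j, a j)) (nz G d (a k))
  have := card_nz_le_three (d := d) hG.1 (a k)
  omega

theorem card_nz_neighbor (hG : MinCounter V G) (h : Avoids G {y} M d) (k : Fin 3) {w : V}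
    (hw : G.Adj (a k) w) : (nz G d w).card ≤ 2 := by
  classical
  by_cases hw3 : (G.neighborSet w).ncard = 3
  · by_cases hwM : ∃ z, s(w, z) ∈ M
    · obtain ⟨z, hz⟩ := hwM
      exact card_nz_le_two hG.1 (h.zeroClass.adj _ _ hz) (h.zero _ hz)
    · push Not at hwM
      have haM : ∀ z, s(a k, z) ∉ M := fun z hz => by
        have := card_nz_le_two hG.1 (h.zeroClass.adj _ _ hz) (h.zero _ hz)
        have := C.card_nz_eq_three hG h k
        omega
      have h' := h.insert hw (C.ne_center k)
        (by rintro rfl; exact C.not_adj_center (C.deg_a k) hw.symm)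
        (by rintro _ rfl; exact C.not_adj_center (C.deg_a k))
        (by rintro _ rfl; exact C.not_adj_center hw3)
        (h.zeroClass.insert hw (C.deg_a k) hw3 haM hwM)
      have := C.card_nz_eq_three hG h' k
      have := card_nz_le_two hG.1 hw (h'.zero _ (Or.inl rfl))
      omega
  · have := hG.1 w
    exact (card_nz_le w).trans (by omega)

theorem ends_ne (hG : MinCounter V G) (h : Avoids G {y} M d) {i j : Fin 3} (hij : i ≠ j) :
    a i ≠ a j := fun he => by
  have := C.color_leg_notMem hG h hij
  rw [← he] at this
  exact this (C.leg_mem_nz h i)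

theorem ends_not_adj (hG : MinCounter V G) (h : Avoids G {y} M d) (i j : Fin 3) :
    ¬ G.Adj (a i) (a j) := fun he => by
  have := C.card_nz_neighbor hG h i he
  have := C.card_nz_eq_three hG h j
  omega

end Claw

theorem not_claw [Finite V] (hG : MinCounter V G) {y : V} {x a : Fin 3 → V} : ¬ Claw G y x a := by
  intro C
  obtain ⟨M, d, h⟩ := exists_avoids hG (Set.mem_singleton y) (C.adj_center 0)
  have hB : ∀ k, ∃ B : Finset (Fin 8), B.card ≤ 5 ∧ 0 ∈ B ∧
      ∀ w, G.Adj (a k) w → w ≠ x k → nz G d w ⊆ B := by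
    intro k
    obtain ⟨w₁, w₂, h₁, h₂, h₁₂⟩ := exists_two_neighbors hG.1 (C.adj_leg k).symm
    have c₁ := C.card_nz_neighbor hG h k h₁
    have c₂ := C.card_nz_neighbor hG h k h₂
    have c₃ := Finset.card_union_le (nz G d w₁) (nz G d w₂)
    refine ⟨insert 0 (nz G d w₁ ∪ nz G d w₂), (Finset.card_insert_le _ _).trans (by omega),
      by simp, fun w hw hwx => ?_⟩
    rcases h₁₂ w hw with rfl | rfl | rfl
    · exact absurd rfl hwx
    · exact Finset.subset_union_left.trans (Finset.subset_insert _ _)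
    · exact Finset.subset_union_right.trans (Finset.subset_insert _ _)
  choose B hB5 hB0 hBw using hB
  obtain ⟨i, j, hij, σ, hi, hj⟩ : ∃ i j, i ≠ j ∧ ∃ σ, σ ∉ B i ∧ σ ∉ B j := by
    by_contra! hall
    have hdis : ∀ i j, i ≠ j → Disjoint (B i)ᶜ (B j)ᶜ := fun i j hij =>
      Finset.disjoint_left.2 fun σ hi hj =>
        Finset.mem_compl.1 hj (hall i j hij σ (Finset.mem_compl.1 hi))
    have h1 := Finset.card_biUnion (s := Finset.univ) (t := fun i => (B i)ᶜ)
      fun i _ j _ hij => hdis i j hij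
    have h2 := Finset.card_le_univ (Finset.univ.biUnion fun i => (B i)ᶜ)
    simp only [Finset.card_compl, Fintype.card_fin, Fin.sum_univ_three] at h1 h2
    have := hB5 0
    have := hB5 1
    have := hB5 2
    omega
  have hσ : σ ≠ 0 := by rintro rfl; exact hi (hB0 i)
  obtain ⟨d₁, h₁, hi₁, e₁⟩ := C.recolor h hσ i fun w hw hwx hm => hi (hBw i w hw hwx hm)
  obtain ⟨d₂, h₂, hj₂, e₂⟩ := C.recolor h₁ hσ j fun w hw hwx hm => hj <| hBw j w hw hwx <| by
    rwa [nz_congr fun z _ => e₁ _ fun he => ?_] at hm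
    rcases Sym2.eq_iff.1 he with ⟨rfl, -⟩ | ⟨rfl, -⟩
    · rcases (C.leg i _).1 hw.symm with h' | h'
      · exact C.ne_center j h'
      · exact C.ends_ne hG h hij h'.symm
    · exact C.ends_not_adj hG h j i hw
  refine C.color_leg_ne hG h₂ hij ?_
  rw [hj₂, e₂, hi₁]
  intro he
  rcases Sym2.eq_iff.1 he with ⟨he, -⟩ | ⟨he, -⟩
  · exact hij (C.inj _ _ he)
  · exact C.ne_leaf (C.deg_a j) i he.symm

theorem length_le_of_shortest {u v : V} {w : G.Walk u v} (hw : ∀ q : G.Walk u v, w.length ≤ q.length)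
    {i j : ℕ} (hi : i ≤ w.length) (hj : j ≤ w.length)
    (q : G.Walk (w.getVert i) (w.getVert j)) : j ≤ i + q.length := by
  have := hw (((w.take i).append q).append (w.drop j))
  simp only [Walk.length_append, Walk.take_length, Walk.drop_length] at this
  omega

section Construction

variable [Finite V]

theorem ncard_eq_three_of_adj (hG : MinCounter V G) {v w : V} (h : G.Adj v w)
    (h2 : (G.neighborSet v).ncard ≠ 2) : (G.neighborSet v).ncard = 3 := by
  have h1 := ncard_neighborSet_ne_one hG v
  have h0 : 0 < (G.neighborSet v).ncard := (Set.ncard_pos (Set.toFinite _)).2 ⟨w, h⟩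
  have := hG.1 v
  omega

theorem exists_other_of_ncard_two {v x : V} (h2 : (G.neighborSet v).ncard = 2) (hx : G.Adj v x) :
    ∃ y, y ≠ x ∧ ∀ z, G.Adj v z ↔ z = x ∨ z = y := by
  obtain ⟨w, hw⟩ := exists_other_neighbor h2.le hx
  obtain ⟨y, hy, hyx⟩ := Set.exists_ne_of_one_lt_ncard (s := G.neighborSet v) (by omega) x
  refine ⟨y, hyx, fun z => ⟨fun hz => ?_, ?_⟩⟩
  · have := hw y hy
    have := hw z hz
    grind
  · rintro (rfl | rfl)
    exacts [hx, hy]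

theorem exists_other_of_ncard_three {v x y : V} (h3 : (G.neighborSet v).ncard = 3)
    (hx : G.Adj v x) (hy : G.Adj v y) (hxy : x ≠ y) :
    ∃ w, w ≠ x ∧ w ≠ y ∧ ∀ z, G.Adj v z ↔ z = x ∨ z = y ∨ z = w := by
  have hsub : ({x, y} : Set V) ⊆ G.neighborSet v := by
    rintro z (rfl | rfl) <;> assumption
  have h1 : (G.neighborSet v \ {x, y}).ncard = 1 := by
    rw [Set.ncard_sdiff hsub, h3, Set.ncard_pair hxy]
  obtain ⟨w, hw⟩ := Set.ncard_eq_one.1 h1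
  have key : ∀ z, (G.Adj v z ∧ ¬ (z = x ∨ z = y)) ↔ z = w := fun z => by
    rw [← Set.mem_singleton_iff (a := z) (b := w), ← hw]
    simp
  have hww := (key w).2 rfl
  refine ⟨w, by tauto, by tauto, fun z => ⟨fun hz => ?_, ?_⟩⟩
  · have := key z
    tauto
  · rintro (rfl | rfl | rfl)
    exacts [hx, hy, hww.1]

theorem exists_adj_of_center (hG : MinCounter V G) {y u v w : V}
    (hy : ∀ z, G.Adj y z ↔ z = u ∨ z = v ∨ z = w) (hu : (G.neighborSet u).ncard = 2)
    (hv : (G.neighborSet v).ncard = 2) (hw : (G.neighborSet w).ncard = 2) (huv : u ≠ v)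
    (huw : u ≠ w) (hvw : v ≠ w) :
    ∃ x x', G.Adj x x' ∧ (G.neighborSet x).ncard = 2 ∧ (G.neighborSet x').ncard = 2 := by
  by_contra! h
  obtain ⟨x, rfl, rfl, rfl⟩ : ∃ x : Fin 3 → V, x 0 = u ∧ x 1 = v ∧ x 2 = w :=
    ⟨![u, v, w], rfl, rfl, rfl⟩
  have hx : ∀ i, (G.neighborSet (x i)).ncard = 2 := by
    intro i
    fin_cases i <;> assumption
  have hyx : ∀ z, G.Adj y z ↔ ∃ i, z = x i := fun z => by
    rw [hy, Fin.exists_fin_succ, Fin.exists_fin_two]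
    rfl
  have hinj : ∀ i j, x i = x j → i = j := by
    intro i j hij
    by_contra hne
    fin_cases i <;> fin_cases j
    exacts [hne rfl, huv hij, huw hij, huv hij.symm, hne rfl, hvw hij, huw hij.symm,
      hvw hij.symm, hne rfl]
  choose a ha haN using fun i => exists_other_of_ncard_two (hx i) ((hyx _).2 ⟨i, rfl⟩).symm
  have hadj : ∀ i, G.Adj (x i) (a i) := fun i => (haN i _).2 (Or.inr rfl)
  exact not_claw hG ⟨hyx, haN, hinj, ha, fun i =>
    ncard_eq_three_of_adj hG (hadj i).symm (h _ _ (hadj i) (hx i))⟩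

/-- Each vertex of an induced path with ends of degree 2 and inner vertices of degree 3 has a
unique neighbor off the path. -/
theorem exists_off_path {m : ℕ} {p : ℕ → V} (h0 : (G.neighborSet (p 0)).ncard = 2)
    (hl : (G.neighborSet (p (m + 1))).ncard = 2) (hadj : ∀ i, i ≤ m → G.Adj (p i) (p (i + 1)))
    (hinj : ∀ i j, i ≤ m + 1 → j ≤ m + 1 → p i = p j → i = j)
    (hadj' : ∀ i j, i ≤ m + 1 → j ≤ m + 1 → G.Adj (p i) (p j) → j = i + 1 ∨ j + 1 = i)
    (hdeg : ∀ i, i < m → (G.neighborSet (p (i + 1))).ncard = 3) (i : ℕ) :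
    ∃ t, i ≤ m + 1 → (∀ j, j ≤ m + 1 → t ≠ p j) ∧
      ∀ z, G.Adj (p i) z ↔ z = t ∨ ∃ j ≤ m + 1, (j = i + 1 ∨ j + 1 = i) ∧ z = p j := by
  suffices i ≤ m + 1 → ∃ t, (∀ j, j ≤ m + 1 → (j = i + 1 ∨ j + 1 = i) → t ≠ p j) ∧
      ∀ z, G.Adj (p i) z ↔ z = t ∨ ∃ j ≤ m + 1, (j = i + 1 ∨ j + 1 = i) ∧ z = p j by
    by_cases hi : i ≤ m + 1
    · obtain ⟨t, h1, h2⟩ := this hi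
      refine ⟨t, fun _ => ⟨fun j hj he => ?_, h2⟩⟩
      exact h1 j hj (hadj' i j hi hj (he ▸ (h2 t).2 (Or.inl rfl))) he
    · exact ⟨p 0, fun h => absurd h hi⟩
  intro hi
  rcases i with _ | i
  · obtain ⟨t, h1, h2⟩ := exists_other_of_ncard_two h0 (hadj 0 (by omega))
    refine ⟨t, fun j hj hj' => ?_, fun z => (h2 z).trans ⟨?_, ?_⟩⟩
    · obtain rfl : j = 0 + 1 := by omega
      exact h1
    · rintro (rfl | rfl)
      exacts [Or.inr ⟨1, by omega, by omega, rfl⟩, Or.inl rfl]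
    · rintro (rfl | ⟨j, hj, hj', rfl⟩)
      · exact Or.inr rfl
      · obtain rfl : j = 0 + 1 := by omega
        exact Or.inl rfl
  · by_cases hi' : i < m
    · obtain ⟨t, h1, h1', h2⟩ := exists_other_of_ncard_three (hdeg i hi')
        (hadj i (by omega)).symm (hadj (i + 1) hi')
        (fun he => by have := hinj _ _ (by omega) (by omega) he; omega)
      refine ⟨t, fun j hj hj' => ?_, fun z => (h2 z).trans ⟨?_, ?_⟩⟩
      · obtain rfl | rfl : j = i ∨ j = i + 1 + 1 := by omega
        exacts [h1, h1']
      · rintro (rfl | rfl | rfl)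
        exacts [Or.inr ⟨i, by omega, by omega, rfl⟩, Or.inr ⟨i + 1 + 1, by omega, by omega, rfl⟩,
          Or.inl rfl]
      · rintro (rfl | ⟨j, hj, hj', rfl⟩)
        · exact Or.inr (Or.inr rfl)
        · obtain rfl | rfl : j = i ∨ j = i + 1 + 1 := by omega
          exacts [Or.inl rfl, Or.inr (Or.inl rfl)]
    · obtain rfl : i = m := by omega
      obtain ⟨t, h1, h2⟩ := exists_other_of_ncard_two hl (hadj i le_rfl).symm
      refine ⟨t, fun j hj hj' => ?_, fun z => (h2 z).trans ⟨?_, ?_⟩⟩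
      · obtain rfl : j = i := by omega
        exact h1
      · rintro (rfl | rfl)
        exacts [Or.inr ⟨i, by omega, by omega, rfl⟩, Or.inl rfl]
      · rintro (rfl | ⟨j, hj, hj', rfl⟩)
        · exact Or.inr rfl
        · obtain rfl : j = i := by omega
          exact Or.inl rfl

theorem eq_of_ncard_two (hG : MinCounter V G) (u v : V) (hu : (G.neighborSet u).ncard = 2)
    (hv : (G.neighborSet v).ncard = 2) : u = v := by
  by_contra huv
  obtain ⟨⟨u, v⟩, ⟨huv, hu, hv⟩, hmin⟩ :=
    (measure fun x : V × V => G.dist x.1 x.2).wf.has_min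
      {x | x.1 ≠ x.2 ∧ (G.neighborSet x.1).ncard = 2 ∧ (G.neighborSet x.2).ncard = 2}
      ⟨(u, v), huv, hu, hv⟩
  replace hmin : ∀ x y, x ≠ y → (G.neighborSet x).ncard = 2 → (G.neighborSet y).ncard = 2 →
      G.dist u v ≤ G.dist x y := fun x y h hx hy => not_lt.1 (hmin (x, y) ⟨h, hx, hy⟩)
  dsimp only at huv hu hv
  have hne : ∀ v : V, (G.neighborSet v).ncard = 2 → ∃ w, G.Adj v w := fun v hv =>
    (Set.ncard_pos (Set.toFinite _)).1 (by omega : 0 < (G.neighborSet v).ncard)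
  obtain ⟨u', hu'⟩ := hne u hu
  obtain ⟨v', hv'⟩ := hne v hv
  obtain ⟨w, hw⟩ := (reachable_of_minCounter hG hu' hv').exists_walk_length_eq_dist
  have hmin' : ∀ x y, x ≠ y → (G.neighborSet x).ncard = 2 → (G.neighborSet y).ncard = 2 →
      ∀ q : G.Walk x y, w.length ≤ q.length := fun x y h hx hy q =>
    hw ▸ (hmin x y h hx hy).trans (dist_le q)
  have hlen := fun {i j : ℕ} => length_le_of_shortest (i := i) (j := j) (hmin' u v huv hu hv)
  obtain ⟨m, hm⟩ : ∃ m, w.length = m + 1 := by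
    refine Nat.exists_eq_succ_of_ne_zero fun h0 => huv (Walk.eq_of_length_eq_zero h0)
  set p : ℕ → V := w.getVert with hp
  have hp0 : p 0 = u := w.getVert_zero
  have hpl : p (m + 1) = v := by rw [← hm]; exact w.getVert_length
  have hadj : ∀ i, i ≤ m → G.Adj (p i) (p (i + 1)) := fun i hi => w.adj_getVert_succ (by omega)
  have hinj : ∀ i j, i ≤ m + 1 → j ≤ m + 1 → p i = p j → i = j := by
    intro i j hi hj he
    have h1 := hlen (by omega) (by omega) (Walk.nil.copy rfl he)
    have h2 := hlen (by omega) (by omega) (Walk.nil.copy rfl he.symm)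
    simp at h1 h2
    omega
  have hadj' : ∀ i j, i ≤ m + 1 → j ≤ m + 1 → G.Adj (p i) (p j) → j = i + 1 ∨ j + 1 = i := by
    intro i j hi hj he
    have h1 := hlen (by omega) (by omega) he.toWalk
    have h2 := hlen (by omega) (by omega) he.symm.toWalk
    have h3 : i ≠ j := by rintro rfl; exact G.irrefl he
    simp at h1 h2
    omega
  have hdeg : ∀ i, i < m → (G.neighborSet (p (i + 1))).ncard = 3 := by
    intro i hi
    refine ncard_eq_three_of_adj hG (hadj _ hi) fun h2 => ?_
    have h1 := hmin' u (p (i + 1)) (fun he => ?_) hu h2 (w.take (i + 1))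
    · rw [Walk.take_length] at h1
      omega
    · have := hinj 0 (i + 1) (by omega) (by omega) (hp0.trans he)
      omega
  have ht := exists_off_path (hp0 ▸ hu) (hpl ▸ hv) hadj hinj hadj' hdeg
  choose t ht using ht
  have hoff : ∀ i j, i ≤ m + 1 → j ≤ m + 1 → t i ≠ p j := fun i j hi hj => (ht i hi).1 j hj
  have hpt : ∀ i, i ≤ m + 1 → G.Adj (p i) (t i) := fun i hi => ((ht i hi).2 _).2 (Or.inl rfl)
  have hmid : ∀ i, i < m → ∀ z, G.Adj (p (i + 1)) z ↔ z = p i ∨ z = p (i + 2) ∨ z = t (i + 1) := by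
    intro i hi z
    refine ((ht (i + 1) (by omega)).2 z).trans ⟨?_, ?_⟩
    · rintro (rfl | ⟨j, hj, hj', rfl⟩)
      · exact Or.inr (Or.inr rfl)
      · obtain rfl | rfl : j = i ∨ j = i + 2 := by omega
        exacts [Or.inl rfl, Or.inr (Or.inl rfl)]
    · rintro (rfl | rfl | rfl)
      exacts [Or.inr ⟨i, by omega, by omega, rfl⟩, Or.inr ⟨i + 2, by omega, by omega, rfl⟩,
        Or.inl rfl]
  refine not_ladder hG (m := m) (p := p) (t := t)
    ⟨hinj, hoff, fun z => ((ht 0 (by omega)).2 z).trans ⟨?_, ?_⟩, hmid,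
      fun z => ((ht (m + 1) le_rfl).2 z).trans ⟨?_, ?_⟩, fun i j hij hj he => ?_,
      fun i hi => ?_, hdeg⟩
  · rintro (rfl | ⟨j, hj, hj', rfl⟩)
    · exact Or.inr rfl
    · obtain rfl : j = 1 := by omega
      exact Or.inl rfl
  · rintro (rfl | rfl)
    exacts [Or.inr ⟨1, by omega, by omega, rfl⟩, Or.inl rfl]
  · rintro (rfl | ⟨j, hj, hj', rfl⟩)
    · exact Or.inr rfl
    · obtain rfl : j = m := by omega
      exact Or.inl rfl
  · rintro (rfl | rfl)
    exacts [Or.inr ⟨m, by omega, by omega, rfl⟩, Or.inl rfl]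
  · have h1 := hpt j hj
    rw [← he] at h1
    exact hlen (by omega) (by omega) (.cons (hpt i (by omega)) h1.symm.toWalk)
  · refine ncard_eq_three_of_adj hG (hpt (i + 1) (by omega)).symm fun h2 => ?_
    have hit := hpt (i + 1) (by omega)
    have h3 := hmin' u (t (i + 1)) (fun he => hoff (i + 1) 0 (by omega) (by omega)
      (he.symm.trans hp0.symm)) hu h2 ((w.take (i + 1)).concat hit)
    have h4 := hmin' (t (i + 1)) v (fun he => hoff (i + 1) (m + 1) (by omega) le_rfl
      (he.trans hpl.symm)) h2 hv (.cons hit.symm (w.drop (i + 1)))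
    simp only [Walk.length_concat, Walk.length_cons, Walk.take_length, Walk.drop_length] at h3 h4
    obtain ⟨rfl, rfl⟩ : i = 0 ∧ m = 1 := by omega
    obtain ⟨x, y, hxy, hx, hy⟩ := exists_adj_of_center hG (hmid 0 hi) (hp0 ▸ hu) (hpl ▸ hv) h2
      (fun he => by have := hinj _ _ (by omega) (by omega) he; omega)
      (hoff _ _ (by omega) (by omega)).symm (hoff _ _ (by omega) (by omega)).symm
    have := hmin' x y hxy.ne hx hy hxy.toWalk
    simp at this
    omega

end Construction

end PackingColoring

/-- A minimal counterexample has at most one vertex of degree 2. -/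
theorem minCounter_at_most_one_deg2 {V : Type} [Finite V] (G : SimpleGraph V)
    (hG : MinCounter V G) :
    ∀ u v : V, (G.neighborSet u).ncard = 2 → (G.neighborSet v).ncard = 2 → u = v :=
  PackingColoring.eq_of_ncard_two hG
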